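/- arXiv:2103.16837 — 3 statements merged into one kernel-verified Lean document; each statement's English description precedes it below -/
import Mathlib

section
/- Let P ⊆ ℝⁿ be a nonempty convex polyhedron (a finite intersection of closed half-spaces), where ℝⁿ carries its standard inner product. For each nonempty face Q of P (including P itself), let V_P^Q be the set of all x ∈ ℝⁿ such that the unique nearest point of P to x lies in the relative interior of Q. Then (1) each V_P^Q is a convex set whose closure is a convex polyhedron, and (2) ℝⁿ is the disjoint union of the sets V_P^Q as Q ranges over the nonempty faces of P. -/
open Set MeasureTheory
open scoped RealInnerProductSpace BigOperators Classical Pointwise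

noncomputable section

/-- Euclidean space `ℝⁿ` with its standard inner product. -/
abbrev Euc (n : ℕ) := EuclideanSpace ℝ (Fin n)

variable {n : ℕ}

/-- A convex polyhedron: a finite intersection of closed half-spaces. -/
def IsPolyhedron (P : Set (Euc n)) : Prop :=
  ∃ S : Finset (Euc n × ℝ), (∀ p ∈ S, p.1 ≠ 0) ∧ P = ⋂ p ∈ S, {x | ⟪x, p.1⟫ ≤ p.2}

/-- `Q` is a face of `P`: either `Q = P` or `Q` is the intersection of `P` with a
supporting hyperplane. -/
def IsPolyFace (P Q : Set (Euc n)) : Prop :=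
  Q = P ∨ ∃ u : Euc n, u ≠ 0 ∧ ∃ r : ℝ, (∀ y ∈ P, ⟪y, u⟫ ≤ r) ∧ Q = {y ∈ P | ⟪y, u⟫ = r}

/-- `V_P^Q`: the set of points `x` whose (unique) nearest point in `P` lies in the relative
interior of the face `Q`. -/
def nearestFaceSet (P Q : Set (Euc n)) : Set (Euc n) :=
  {x | ∃ q ∈ intrinsicInterior ℝ Q, q ∈ P ∧ ∀ p ∈ P, dist x q ≤ dist x p}

open scoped Topology

/-- The solution set of the linear inequalities `⟪x, p.1⟫ ≤ p.2`, where `p.1 = 0` is allowed. -/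
def halfspaces (S : Finset (Euc n × ℝ)) : Set (Euc n) :=
  {x | ∀ p ∈ S, ⟪x, p.1⟫ ≤ p.2}

/-- The inequalities of the system `S` that are equalities at `q`. -/
def activeSet (S : Finset (Euc n × ℝ)) (q : Euc n) : Finset (Euc n × ℝ) :=
  {p ∈ S | ⟪q, p.1⟫ = p.2}

/-- The outer normal cone of `P` at `q`. -/
def normalCone (P : Set (Euc n)) (q : Euc n) : Set (Euc n) :=
  {u | ∀ p ∈ P, ⟪u, p - q⟫ ≤ 0}

theorem mem_halfspaces {S : Finset (Euc n × ℝ)} {x : Euc n} :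
    x ∈ halfspaces S ↔ ∀ p ∈ S, ⟪x, p.1⟫ ≤ p.2 := Iff.rfl

theorem mem_activeSet {S : Finset (Euc n × ℝ)} {q : Euc n} {p : Euc n × ℝ} :
    p ∈ activeSet S q ↔ p ∈ S ∧ ⟪q, p.1⟫ = p.2 := by
  simp [activeSet]

theorem isClosed_halfspaces (S : Finset (Euc n × ℝ)) : IsClosed (halfspaces S) := by
  simp only [halfspaces, ofPred_forall]
  exact isClosed_biInter fun p _ => isClosed_le (by fun_prop) (by fun_prop)

theorem convex_halfspaces (S : Finset (Euc n × ℝ)) : Convex ℝ (halfspaces S) := by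
  intro x hx y hy s t hs ht hst p hp
  rw [inner_add_left, real_inner_smul_left, real_inner_smul_left]
  calc s * ⟪x, p.1⟫ + t * ⟪y, p.1⟫ ≤ s * p.2 + t * p.2 := by
        gcongr
        · exact hx p hp
        · exact hy p hp
    _ = p.2 := by rw [← add_mul, hst, one_mul]

theorem isPolyhedron_halfspaces {S : Finset (Euc n × ℝ)} (h : (halfspaces S).Nonempty) :
    IsPolyhedron (halfspaces S) := by
  obtain ⟨y, hy⟩ := h
  refine ⟨{p ∈ S | p.1 ≠ 0}, by simp, ?_⟩
  ext x
  simp only [mem_halfspaces, mem_iInter, mem_ofPred_eq, Finset.mem_filter, and_imp]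
  refine ⟨fun h p hp _ => h p hp, fun h p hp => ?_⟩
  by_cases h0 : p.1 = 0
  · simpa [h0] using hy p hp
  · exact h p hp h0

theorem IsPolyhedron.exists_eq_halfspaces {P : Set (Euc n)} (h : IsPolyhedron P) :
    ∃ S, P = halfspaces S := by
  obtain ⟨S, -, rfl⟩ := h
  exact ⟨S, by ext; simp [mem_halfspaces]⟩

/-- Fourier–Motzkin elimination: the Minkowski sum of a polyhedron and a ray is a polyhedron. -/
theorem exists_halfspaces_add_ray (S : Finset (Euc n × ℝ)) (a : Euc n) :
    ∃ T : Finset (Euc n × ℝ), ∀ x, x ∈ halfspaces T ↔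
      ∃ t : ℝ, 0 ≤ t ∧ x - t • a ∈ halfspaces S := by
  let A := {p ∈ S | 0 < ⟪a, p.1⟫}
  let B := {p ∈ S | ⟪a, p.1⟫ ≤ 0}
  let comb (z : (Euc n × ℝ) × (Euc n × ℝ)) : Euc n × ℝ :=
    ⟪a, z.1.1⟫ • z.2 - ⟪a, z.2.1⟫ • z.1
  refine ⟨B ∪ (A ×ˢ B).image comb, fun x => ⟨fun hx => ?_, ?_⟩⟩
  · let L := insert 0 (A.image fun p => (⟪x, p.1⟫ - p.2) / ⟪a, p.1⟫)
    have hL : L.Nonempty := Finset.insert_nonempty _ _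
    refine ⟨L.max' hL, L.le_max' _ (Finset.mem_insert_self _ _), fun p hp => ?_⟩
    rw [inner_sub_left, real_inner_smul_left]
    rcases lt_or_ge 0 ⟪a, p.1⟫ with hpos | hneg
    · have h := L.le_max' ((⟪x, p.1⟫ - p.2) / ⟪a, p.1⟫) (Finset.mem_insert_of_mem
        (Finset.mem_image_of_mem _ (Finset.mem_filter.2 ⟨hp, hpos⟩)))
      rw [div_le_iff₀ hpos] at h
      linarith
    · have hpB : p ∈ B := Finset.mem_filter.2 ⟨hp, hneg⟩
      rcases Finset.mem_insert.1 (L.max'_mem hL) with h | h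
      · rw [h, zero_mul, sub_zero]
        exact hx p (Finset.mem_union_left _ hpB)
      · obtain ⟨r, hr, hrt⟩ := Finset.mem_image.1 h
        have hr0 : 0 < ⟪a, r.1⟫ := (Finset.mem_filter.1 hr).2
        have h := hx (comb (r, p)) (Finset.mem_union_right _
          (Finset.mem_image_of_mem _ (Finset.mk_mem_product hr hpB)))
        simp only [comb, Prod.fst_sub, Prod.snd_sub, Prod.smul_fst, Prod.smul_snd,
          inner_sub_right, real_inner_smul_right, smul_eq_mul] at h
        rw [← hrt]
        refine le_of_mul_le_mul_left ?_ hr0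
        rw [mul_sub, ← mul_assoc, mul_div_cancel₀ _ hr0.ne']
        linarith
  · rintro ⟨t, ht, h⟩ p hp
    have key : ∀ p ∈ S, ⟪x, p.1⟫ - t * ⟪a, p.1⟫ ≤ p.2 := fun p hp => by
      simpa only [inner_sub_left, real_inner_smul_left] using h p hp
    rcases Finset.mem_union.1 hp with hp | hp
    · obtain ⟨hpS, hp0⟩ := Finset.mem_filter.1 hp
      nlinarith [key p hpS]
    · obtain ⟨⟨r, q⟩, hz, rfl⟩ := Finset.mem_image.1 hp
      obtain ⟨hr, hq⟩ := Finset.mem_product.1 hz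
      obtain ⟨hrS, hr0⟩ := Finset.mem_filter.1 hr
      obtain ⟨hqS, hq0⟩ := Finset.mem_filter.1 hq
      simp only [comb, Prod.fst_sub, Prod.snd_sub, Prod.smul_fst, Prod.smul_snd,
        inner_sub_right, real_inner_smul_right, smul_eq_mul] at *
      nlinarith [mul_le_mul_of_nonneg_left (key q hqS) hr0.le,
        mul_le_mul_of_nonneg_left (key r hrS) (neg_nonneg.2 hq0)]

/-- The Minkowski sum of a polyhedron and a finitely generated cone is a polyhedron. -/
theorem exists_halfspaces_add_cone (S I : Finset (Euc n × ℝ)) :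
    ∃ T : Finset (Euc n × ℝ), ∀ x, x ∈ halfspaces T ↔
      ∃ f : Euc n × ℝ → ℝ, (∀ p, 0 ≤ f p) ∧ x - ∑ p ∈ I, f p • p.1 ∈ halfspaces S := by
  induction I using Finset.induction_on with
  | empty =>
    exact ⟨S, fun x => ⟨fun h => ⟨0, fun _ => le_rfl, by simpa using h⟩,
      fun ⟨_, _, h⟩ => by simpa using h⟩⟩
  | insert a I ha ih =>
    obtain ⟨T, hT⟩ := ih
    obtain ⟨T', hT'⟩ := exists_halfspaces_add_ray T a.1
    refine ⟨T', fun x => ?_⟩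
    rw [hT']
    constructor
    · rintro ⟨t, ht, h⟩
      obtain ⟨f, hf, h⟩ := (hT _).1 h
      refine ⟨Function.update f a t, fun p => ?_, ?_⟩
      · by_cases hp : p = a
        · subst hp; simpa using ht
        · simpa [hp] using hf p
      · rw [Finset.sum_insert ha, Function.update_self, ← sub_sub,
          Finset.sum_congr rfl fun p hp => by
            rw [Function.update_of_ne (ne_of_mem_of_not_mem hp ha)]]
        exact h
    · rintro ⟨f, hf, h⟩
      rw [Finset.sum_insert ha, ← sub_sub] at h
      exact ⟨f a, hf a, (hT _).2 ⟨f, hf, h⟩⟩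

theorem exists_halfspaces_eq_singleton_zero :
    ∃ S : Finset (Euc n × ℝ), halfspaces S = {0} := by
  refine ⟨Finset.univ.image (fun i => (EuclideanSpace.single i (1 : ℝ), (0 : ℝ))) ∪
    Finset.univ.image (fun i => (-EuclideanSpace.single i (1 : ℝ), (0 : ℝ))), ?_⟩
  ext x
  rw [mem_singleton_iff]
  constructor
  · intro h
    ext i
    have h1 := h _ (Finset.mem_union_left _ (Finset.mem_image_of_mem _ (Finset.mem_univ i)))
    have h2 := h _ (Finset.mem_union_right _ (Finset.mem_image_of_mem _ (Finset.mem_univ i)))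
    simp only [inner_neg_right, EuclideanSpace.inner_single_right, one_mul, conj_trivial] at h1 h2
    exact le_antisymm h1 (by simpa using h2)
  · rintro rfl p hp
    rcases Finset.mem_union.1 hp with hp | hp <;> obtain ⟨i, -, rfl⟩ := Finset.mem_image.1 hp <;>
      simp

/-- Perturbing a point of a polyhedron in a direction that does not violate the active
constraints stays in the polyhedron. -/
theorem exists_pos_add_smul_mem_halfspaces {S : Finset (Euc n × ℝ)} {q v : Euc n}
    (hq : q ∈ halfspaces S) (hv : ∀ p ∈ activeSet S q, ⟪v, p.1⟫ ≤ 0) :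
    ∃ ε : ℝ, 0 < ε ∧ q + ε • v ∈ halfspaces S := by
  have h : ∀ᶠ ε in 𝓝[>] (0 : ℝ), ∀ p ∈ S, ⟪q + ε • v, p.1⟫ ≤ p.2 := by
    rw [Filter.eventually_all_finset]
    intro p hp
    rcases (hq p hp).lt_or_eq with hlt | heq
    · have hc : ContinuousAt (fun ε : ℝ => ⟪q + ε • v, p.1⟫) 0 := by fun_prop
      refine ((hc.eventually_lt continuousAt_const ?_).filter_mono nhdsWithin_le_nhds).mono
        fun _ h => h.le
      simpa using hlt
    · filter_upwards [self_mem_nhdsWithin] with ε hε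
      rw [inner_add_left, real_inner_smul_left, heq]
      have := mul_nonpos_of_nonneg_of_nonpos (le_of_lt hε) (hv p (mem_activeSet.2 ⟨hp, heq⟩))
      linarith
  obtain ⟨ε, h, hε⟩ := (h.and self_mem_nhdsWithin).exists
  exact ⟨ε, hε, h⟩

theorem sum_smul_mem_normalCone {S : Finset (Euc n × ℝ)} {q : Euc n} {f : Euc n × ℝ → ℝ}
    (hf : ∀ p, 0 ≤ f p) : ∑ p ∈ activeSet S q, f p • p.1 ∈ normalCone (halfspaces S) q := by
  intro y hy
  rw [sum_inner]
  refine Finset.sum_nonpos fun p hp => ?_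
  obtain ⟨hpS, hpq⟩ := mem_activeSet.1 hp
  rw [real_inner_smul_left, inner_sub_right, real_inner_comm, real_inner_comm q, hpq]
  exact mul_nonpos_of_nonneg_of_nonpos (hf p) (sub_nonpos.2 (hy p hpS))

/-- Farkas' lemma: the normal cone of a polyhedron is generated by the active normals. -/
theorem exists_eq_sum_of_mem_normalCone {S : Finset (Euc n × ℝ)} {q u : Euc n}
    (hq : q ∈ halfspaces S) (hu : u ∈ normalCone (halfspaces S) q) :
    ∃ f : Euc n × ℝ → ℝ, (∀ p, 0 ≤ f p) ∧ u = ∑ p ∈ activeSet S q, f p • p.1 := by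
  obtain ⟨Z, hZ⟩ := exists_halfspaces_eq_singleton_zero (n := n)
  obtain ⟨T, hT⟩ := exists_halfspaces_add_cone Z (activeSet S q)
  simp only [hZ, mem_singleton_iff, sub_eq_zero] at hT
  refine (hT u).1 fun r hr => ?_
  have h0 : 0 ≤ r.2 := by
    simpa using (hT 0).2 ⟨0, fun _ => le_rfl, by simp⟩ r hr
  obtain ⟨ε, hε, hmem⟩ := exists_pos_add_smul_mem_halfspaces (v := r.1) hq fun p hp => by
    by_contra! hpos
    have hmem : ((r.2 + 1) / ⟪r.1, p.1⟫) • p.1 ∈ halfspaces T :=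
      (hT _).2 ⟨Pi.single p ((r.2 + 1) / ⟪r.1, p.1⟫), fun p' => by
        rw [Pi.single_apply]; split_ifs <;> positivity, by
        simp [Pi.single_apply, ite_smul, hp]⟩
    have := hmem r hr
    rw [real_inner_smul_left, real_inner_comm r.1 p.1, div_mul_cancel₀ _ hpos.ne'] at this
    linarith
  have h := hu _ hmem
  rw [add_sub_cancel_left, real_inner_smul_right] at h
  exact (nonpos_of_mul_nonpos_right h hε).trans h0

theorem exists_pos_add_smul_sub_mem {Q : Set (Euc n)} {q q' : Euc n}
    (hq : q ∈ intrinsicInterior ℝ Q) (hq' : q' ∈ Q) :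
    ∃ ε : ℝ, 0 < ε ∧ q + ε • (q - q') ∈ Q := by
  obtain ⟨y, hy, rfl⟩ := mem_intrinsicInterior.1 hq
  let g (ε : ℝ) : affineSpan ℝ Q := ⟨AffineMap.lineMap (y : Euc n) q' (-ε),
    AffineMap.lineMap_mem _ y.2 (subset_affineSpan ℝ Q hq')⟩
  have hg : Continuous g := by
    refine Continuous.subtype_mk ?_ _
    simp only [AffineMap.lineMap_apply_module']
    fun_prop
  have hg0 : g 0 = y := by ext1; simp [g]
  have h : ∀ᶠ ε in 𝓝[>] (0 : ℝ), (g ε : Euc n) ∈ Q :=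
    (hg.continuousAt.eventually_mem (hg0 ▸ mem_interior_iff_mem_nhds.1 hy)).filter_mono
      nhdsWithin_le_nhds
  obtain ⟨ε, h, hε⟩ := (h.and self_mem_nhdsWithin).exists
  refine ⟨ε, hε, ?_⟩
  convert h using 1
  simp only [g, AffineMap.lineMap_apply_module']
  module

theorem inner_eq_of_mem_intrinsicInterior {P Q : Set (Euc n)} {q q' u : Euc n} (hQP : Q ⊆ P)
    (hq : q ∈ intrinsicInterior ℝ Q) (hq' : q' ∈ Q) (hu : u ∈ normalCone P q) :
    ⟪u, q'⟫ = ⟪u, q⟫ := by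
  obtain ⟨ε, hε, h⟩ := exists_pos_add_smul_sub_mem hq hq'
  have h1 := hu _ (hQP h)
  have h2 := hu _ (hQP hq')
  rw [add_sub_cancel_left, real_inner_smul_right] at h1
  have h3 := nonpos_of_mul_nonpos_right h1 hε
  rw [inner_sub_right] at h2 h3
  linarith

theorem normalCone_subset_of_mem_intrinsicInterior {P Q : Set (Euc n)} {q q' : Euc n}
    (hQP : Q ⊆ P) (hq : q ∈ intrinsicInterior ℝ Q) (hq' : q' ∈ Q) :
    normalCone P q ⊆ normalCone P q' := by
  intro u hu p hp
  have := inner_eq_of_mem_intrinsicInterior hQP hq hq' hu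
  have := hu p hp
  rw [inner_sub_right] at *
  linarith

theorem IsPolyFace.subset {P Q : Set (Euc n)} (h : IsPolyFace P Q) : Q ⊆ P := by
  rcases h with rfl | ⟨u, -, r, -, rfl⟩
  · exact Subset.rfl
  · exact sep_subset _ _

/-- A face that meets the relative interior of a subset contains that subset. -/
theorem IsPolyFace.subset_of_mem_intrinsicInterior {P Q Q' : Set (Euc n)} {q : Euc n}
    (h : IsPolyFace P Q) (hQ' : Q' ⊆ P) (hq : q ∈ Q) (hq' : q ∈ intrinsicInterior ℝ Q') :
    Q' ⊆ Q := by
  rcases h with rfl | ⟨u, -, r, hr, rfl⟩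
  · exact hQ'
  · intro y hy
    refine ⟨hQ' hy, ?_⟩
    have hu : u ∈ normalCone P q := fun p hp => by
      rw [inner_sub_right, real_inner_comm, real_inner_comm q, hq.2]
      exact sub_nonpos.2 (hr p hp)
    rw [real_inner_comm, inner_eq_of_mem_intrinsicInterior hQ' hq' hy hu, real_inner_comm, hq.2]

theorem IsPolyFace.eq_of_mem_intrinsicInterior {P Q Q' : Set (Euc n)} {q : Euc n}
    (h : IsPolyFace P Q) (h' : IsPolyFace P Q') (hq : q ∈ intrinsicInterior ℝ Q)
    (hq' : q ∈ intrinsicInterior ℝ Q') : Q = Q' :=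
  (h'.subset_of_mem_intrinsicInterior h.subset (intrinsicInterior_subset hq') hq).antisymm
    (h.subset_of_mem_intrinsicInterior h'.subset (intrinsicInterior_subset hq) hq')

/-- The points of the polyhedron that satisfy with equality all constraints active at `q`. -/
def minimalFace (S : Finset (Euc n × ℝ)) (q : Euc n) : Set (Euc n) :=
  {y ∈ halfspaces S | ∀ p ∈ activeSet S q, ⟪y, p.1⟫ = p.2}

theorem isPolyFace_minimalFace (S : Finset (Euc n × ℝ)) (q : Euc n) :
    IsPolyFace (halfspaces S) (minimalFace S q) := by
  have hle : ∀ y ∈ halfspaces S, ∀ p ∈ activeSet S q, ⟪y, p.1⟫ ≤ p.2 :=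
    fun y hy p hp => hy p (mem_activeSet.1 hp).1
  have hiff : ∀ y ∈ halfspaces S, ⟪y, ∑ p ∈ activeSet S q, p.1⟫ = ∑ p ∈ activeSet S q, p.2 ↔
      ∀ p ∈ activeSet S q, ⟪y, p.1⟫ = p.2 := fun y hy => by
    rw [inner_sum, Finset.sum_eq_sum_iff_of_le (hle y hy)]
  by_cases h0 : ∑ p ∈ activeSet S q, p.1 = 0
  · left
    refine (sep_subset _ _).antisymm fun y hy => ⟨hy, (hiff y hy).1 ?_⟩
    rw [← Finset.sum_congr rfl fun p hp => (mem_activeSet.1 hp).2, ← inner_sum, h0,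
      inner_zero_right, inner_zero_right]
  · right
    refine ⟨_, h0, ∑ p ∈ activeSet S q, p.2, fun y hy => ?_, ?_⟩
    · rw [inner_sum]
      exact Finset.sum_le_sum (hle y hy)
    · ext y
      exact and_congr_right fun hy => (hiff y hy).symm

theorem mem_intrinsicInterior_minimalFace {S : Finset (Euc n × ℝ)} {q : Euc n}
    (hq : q ∈ halfspaces S) : q ∈ intrinsicInterior ℝ (minimalFace S q) := by
  have hqF : q ∈ minimalFace S q := ⟨hq, fun p hp => (mem_activeSet.1 hp).2⟩
  refine mem_intrinsicInterior.2 ⟨⟨q, subset_affineSpan ℝ _ hqF⟩, ?_, rfl⟩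
  have hspan : ∀ y ∈ affineSpan ℝ (minimalFace S q), ∀ p ∈ activeSet S q, ⟪y, p.1⟫ = p.2 := by
    intro y hy p hp
    refine affineSpan_induction (p := fun y => ⟪y, p.1⟫ = p.2) hy (fun y hy => hy.2 p hp) ?_
    intro c u v w hu hv hw
    simp [inner_add_left, inner_sub_left, real_inner_smul_left, hu, hv, hw]
  rw [mem_interior_iff_mem_nhds]
  have h : ∀ᶠ y : affineSpan ℝ (minimalFace S q) in 𝓝 ⟨q, subset_affineSpan ℝ _ hqF⟩,
      ∀ p ∈ S, ⟪(y : Euc n), p.1⟫ ≤ p.2 := by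
    rw [Filter.eventually_all_finset]
    intro p hp
    rcases (hq p hp).lt_or_eq with hlt | heq
    · have hc : Continuous fun y : affineSpan ℝ (minimalFace S q) => ⟪(y : Euc n), p.1⟫ := by
        fun_prop
      exact (hc.continuousAt.eventually_lt continuousAt_const hlt).mono fun _ h => h.le
    · exact Filter.Eventually.of_forall fun y =>
        (hspan y y.2 p (mem_activeSet.2 ⟨hp, heq⟩)).le
  filter_upwards [h] with y hy
  exact ⟨hy, hspan y y.2⟩

theorem IsPolyFace.eq_minimalFace {S : Finset (Euc n × ℝ)} {Q : Set (Euc n)} {q : Euc n}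
    (h : IsPolyFace (halfspaces S) Q) (hq : q ∈ intrinsicInterior ℝ Q) :
    Q = minimalFace S q :=
  h.eq_of_mem_intrinsicInterior (isPolyFace_minimalFace S q) hq
    (mem_intrinsicInterior_minimalFace (h.subset (intrinsicInterior_subset hq)))

/-- The relative interior of a face consists of the points with a given active set. -/
theorem IsPolyFace.mem_intrinsicInterior_iff {S : Finset (Euc n × ℝ)} {Q : Set (Euc n)}
    {q y : Euc n} (h : IsPolyFace (halfspaces S) Q) (hq : q ∈ intrinsicInterior ℝ Q) :
    y ∈ intrinsicInterior ℝ Q ↔ y ∈ halfspaces S ∧ activeSet S y = activeSet S q := by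
  have key : ∀ {a b}, a ∈ intrinsicInterior ℝ Q → b ∈ intrinsicInterior ℝ Q →
      activeSet S a ⊆ activeSet S b := fun {a b} ha hb p hp => by
    have hb' := intrinsicInterior_subset hb
    rw [h.eq_minimalFace ha] at hb'
    exact mem_activeSet.2 ⟨(mem_activeSet.1 hp).1, hb'.2 p hp⟩
  constructor
  · intro hy
    exact ⟨h.subset (intrinsicInterior_subset hy), (key hy hq).antisymm (key hq hy)⟩
  · rintro ⟨hy, hact⟩
    have hQ : Q = minimalFace S y := by
      rw [h.eq_minimalFace hq, minimalFace, minimalFace, hact]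
    rw [hQ]
    exact mem_intrinsicInterior_minimalFace hy

/-- Moving from a point of a face towards a relative interior point enters the relative
interior. -/
theorem IsPolyFace.combo_mem_intrinsicInterior {S : Finset (Euc n × ℝ)} {Q : Set (Euc n)}
    {q y : Euc n} (h : IsPolyFace (halfspaces S) Q) (hq : q ∈ intrinsicInterior ℝ Q)
    (hy : y ∈ Q) {s t : ℝ} (hs : 0 < s) (ht : 0 ≤ t) (hst : s + t = 1) :
    s • q + t • y ∈ intrinsicInterior ℝ Q := by
  have hqP := h.subset (intrinsicInterior_subset hq)
  have hyP := h.subset hy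
  rw [h.eq_minimalFace hq] at hy
  refine (h.mem_intrinsicInterior_iff hq).2
    ⟨convex_halfspaces S hqP hyP hs.le ht hst, Finset.Subset.antisymm ?_ ?_⟩
  · intro p hp
    obtain ⟨hpS, hp⟩ := mem_activeSet.1 hp
    refine mem_activeSet.2 ⟨hpS, (hqP p hpS).antisymm ?_⟩
    rw [inner_add_left, real_inner_smul_left, real_inner_smul_left] at hp
    refine le_of_mul_le_mul_left ?_ hs
    have h1 := mul_le_mul_of_nonneg_left (hyP p hpS) ht
    have h2 : s * p.2 + t * p.2 = p.2 := by rw [← add_mul, hst, one_mul]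
    linarith
  · intro p hp
    refine mem_activeSet.2 ⟨(mem_activeSet.1 hp).1, ?_⟩
    rw [inner_add_left, real_inner_smul_left, real_inner_smul_left, (mem_activeSet.1 hp).2,
      hy.2 p hp, ← add_mul, hst, one_mul]

theorem IsPolyFace.convex_intrinsicInterior {S : Finset (Euc n × ℝ)} {Q : Set (Euc n)}
    (h : IsPolyFace (halfspaces S) Q) : Convex ℝ (intrinsicInterior ℝ Q) :=
  convex_iff_forall_pos.2 fun _ hx _ hy _ _ hs ht hst =>
    h.combo_mem_intrinsicInterior hx (intrinsicInterior_subset hy) hs ht.le hst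

theorem IsPolyFace.subset_closure_intrinsicInterior {S : Finset (Euc n × ℝ)} {Q : Set (Euc n)}
    {q : Euc n} (h : IsPolyFace (halfspaces S) Q) (hq : q ∈ intrinsicInterior ℝ Q) :
    Q ⊆ closure (intrinsicInterior ℝ Q) := by
  intro y hy
  have hc : Continuous fun s : ℝ => s • q + (1 - s) • y := by fun_prop
  have hlim : Filter.Tendsto (fun s : ℝ => s • q + (1 - s) • y) (𝓝[>] 0) (𝓝 y) := by
    have := hc.tendsto 0
    simp only [zero_smul, sub_zero, one_smul, zero_add] at this
    exact this.mono_left nhdsWithin_le_nhds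
  refine mem_closure_of_tendsto hlim ?_
  filter_upwards [Ioo_mem_nhdsGT (zero_lt_one' ℝ)] with s hs
  exact h.combo_mem_intrinsicInterior hq hy hs.1 (sub_nonneg.2 hs.2.le) (by ring)

theorem forall_dist_le_iff_sub_mem_normalCone {P : Set (Euc n)} (hP : Convex ℝ P) {x q : Euc n}
    (hq : q ∈ P) : (∀ p ∈ P, dist x q ≤ dist x p) ↔ x - q ∈ normalCone P q := by
  have : Nonempty P := ⟨⟨q, hq⟩⟩
  rw [normalCone, mem_ofPred_eq, ← norm_eq_iInf_iff_real_inner_le_zero hP hq]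
  simp only [dist_eq_norm]
  have hbdd : BddBelow (range fun w : P => ‖x - w‖) :=
    ⟨0, forall_mem_range.2 fun _ => norm_nonneg _⟩
  constructor
  · intro h
    exact (le_ciInf fun w : P => h w w.2).antisymm (ciInf_le hbdd ⟨q, hq⟩)
  · intro h p hp
    rw [h]
    exact ciInf_le hbdd ⟨p, hp⟩

theorem eq_of_sub_mem_normalCone {P : Set (Euc n)} {x q q' : Euc n} (hq : q ∈ P) (hq' : q' ∈ P)
    (h : x - q ∈ normalCone P q) (h' : x - q' ∈ normalCone P q') : q = q' := by
  have h1 := h q' hq'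
  have h2 := h' q hq
  have h3 : ⟪q - q', q - q'⟫ = ⟪x - q, q' - q⟫ + ⟪x - q', q - q'⟫ := by
    rw [← neg_sub q q', inner_neg_right, ← sub_eq_neg_add, ← inner_sub_left,
      sub_sub_sub_cancel_left]
  have h4 := real_inner_self_nonpos.1 (h3.trans_le (add_nonpos h1 h2))
  exact sub_eq_zero.1 h4

theorem mem_nearestFaceSet_iff {P Q : Set (Euc n)} (hP : Convex ℝ P) (hQP : Q ⊆ P) {x : Euc n} :
    x ∈ nearestFaceSet P Q ↔ ∃ q ∈ intrinsicInterior ℝ Q, x - q ∈ normalCone P q :=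
  exists_congr fun _ => and_congr_right fun hq => by
    have hqP := hQP (intrinsicInterior_subset hq)
    rw [forall_dist_le_iff_sub_mem_normalCone hP hqP, and_iff_right hqP]

theorem convex_normalCone (P : Set (Euc n)) (q : Euc n) : Convex ℝ (normalCone P q) := by
  intro u hu v hv s t hs ht _ p hp
  rw [inner_add_left, real_inner_smul_left, real_inner_smul_left]
  exact add_nonpos (mul_nonpos_of_nonneg_of_nonpos hs (hu p hp))
    (mul_nonpos_of_nonneg_of_nonpos ht (hv p hp))

theorem nearestFaceSet_eq_add {S : Finset (Euc n × ℝ)} {Q : Set (Euc n)} {q : Euc n}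
    (h : IsPolyFace (halfspaces S) Q) (hq : q ∈ intrinsicInterior ℝ Q) :
    nearestFaceSet (halfspaces S) Q = intrinsicInterior ℝ Q + normalCone (halfspaces S) q := by
  ext x
  rw [mem_nearestFaceSet_iff (convex_halfspaces S) h.subset, mem_add]
  constructor
  · rintro ⟨y, hy, hxy⟩
    exact ⟨y, hy, x - y, normalCone_subset_of_mem_intrinsicInterior h.subset hy
      (intrinsicInterior_subset hq) hxy, add_sub_cancel _ _⟩
  · rintro ⟨y, hy, u, hu, rfl⟩
    refine ⟨y, hy, ?_⟩
    rw [add_sub_cancel_left]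
    exact normalCone_subset_of_mem_intrinsicInterior h.subset hq (intrinsicInterior_subset hy) hu

theorem IsPolyFace.exists_eq_halfspaces {S : Finset (Euc n × ℝ)} {Q : Set (Euc n)}
    (h : IsPolyFace (halfspaces S) Q) : ∃ T, Q = halfspaces T := by
  rcases h with rfl | ⟨u, -, r, -, rfl⟩
  · exact ⟨S, rfl⟩
  · refine ⟨insert (u, r) (insert (-u, -r) S), ?_⟩
    ext y
    simp only [mem_ofPred_eq, mem_halfspaces, Finset.forall_mem_insert, inner_neg_right,
      neg_le_neg_iff]
    rw [le_antisymm_iff]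
    tauto

theorem exists_closure_nearestFaceSet_eq_halfspaces {S : Finset (Euc n × ℝ)} {Q : Set (Euc n)}
    {q : Euc n} (h : IsPolyFace (halfspaces S) Q) (hq : q ∈ intrinsicInterior ℝ Q) :
    ∃ T, closure (nearestFaceSet (halfspaces S) Q) = halfspaces T := by
  obtain ⟨R, hR⟩ := h.exists_eq_halfspaces
  obtain ⟨T, hT⟩ := exists_halfspaces_add_cone R (activeSet S q)
  refine ⟨T, Subset.antisymm (closure_minimal ?_ (isClosed_halfspaces T)) ?_⟩
  · rw [nearestFaceSet_eq_add h hq]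
    rintro _ ⟨y, hy, u, hu, rfl⟩
    obtain ⟨f, hf, rfl⟩ :=
      exists_eq_sum_of_mem_normalCone (h.subset (intrinsicInterior_subset hq)) hu
    refine (hT _).2 ⟨f, hf, ?_⟩
    simpa [hR] using intrinsicInterior_subset hy
  · intro x hx
    obtain ⟨f, hf, hx⟩ := (hT x).1 hx
    rw [← hR] at hx
    rw [nearestFaceSet_eq_add h hq]
    rw [← sub_add_cancel x (∑ p ∈ activeSet S q, f p • p.1)]
    exact map_mem_closure₂ continuous_add (h.subset_closure_intrinsicInterior hq hx)
      (subset_closure (sum_smul_mem_normalCone hf)) fun _ ha _ hb => add_mem_add ha hb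

/-- **Nearest face partition.** For a nonempty convex polyhedron `P ⊆ ℝⁿ`: each `V_P^Q` is
convex with polyhedral closure, and `ℝⁿ` is the disjoint union of the `V_P^Q` over the
nonempty faces `Q` of `P`. -/
theorem nearest_face_partition {n : ℕ} (P : Set (Euc n)) (hP : IsPolyhedron P)
    (hne : P.Nonempty) :
    (∀ Q, IsPolyFace P Q → Q.Nonempty →
        Convex ℝ (nearestFaceSet P Q) ∧ IsPolyhedron (closure (nearestFaceSet P Q))) ∧
    (⋃ Q ∈ {Q | IsPolyFace P Q ∧ Q.Nonempty}, nearestFaceSet P Q) = univ ∧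
    (∀ Q₁ Q₂, IsPolyFace P Q₁ → Q₁.Nonempty → IsPolyFace P Q₂ → Q₂.Nonempty → Q₁ ≠ Q₂ →
        Disjoint (nearestFaceSet P Q₁) (nearestFaceSet P Q₂)) := by
  obtain ⟨S, rfl⟩ := hP.exists_eq_halfspaces
  have hconv := convex_halfspaces S
  refine ⟨fun Q hQ hQne => ?_, eq_univ_of_forall fun x => ?_, fun Q₁ Q₂ h₁ _ h₂ _ hne' => ?_⟩
  · have hQconv : Convex ℝ Q := by
      obtain ⟨T, rfl⟩ := hQ.exists_eq_halfspaces
      exact convex_halfspaces T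
    obtain ⟨q, hq⟩ := hQne.intrinsicInterior hQconv
    constructor
    · rw [nearestFaceSet_eq_add hQ hq]
      exact hQ.convex_intrinsicInterior.add (convex_normalCone _ _)
    · obtain ⟨T, hT⟩ := exists_closure_nearestFaceSet_eq_halfspaces hQ hq
      rw [hT]
      refine isPolyhedron_halfspaces ⟨q, hT ▸ subset_closure ?_⟩
      exact (mem_nearestFaceSet_iff hconv hQ.subset).2 ⟨q, hq, by simp [normalCone]⟩
  · obtain ⟨q, hq, hdist⟩ := (isClosed_halfspaces S).exists_infDist_eq_dist hne x
    have hqint := mem_intrinsicInterior_minimalFace hq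
    exact mem_biUnion (x := minimalFace S q)
      ⟨isPolyFace_minimalFace S q, q, intrinsicInterior_subset hqint⟩
      ⟨q, hqint, hq, fun p hp => hdist ▸ Metric.infDist_le_dist_of_mem hp⟩
  · rw [Set.disjoint_left]
    intro x hx₁ hx₂
    obtain ⟨q₁, hq₁, hn₁⟩ := (mem_nearestFaceSet_iff hconv h₁.subset).1 hx₁
    obtain ⟨q₂, hq₂, hn₂⟩ := (mem_nearestFaceSet_iff hconv h₂.subset).1 hx₂
    obtain rfl := eq_of_sub_mem_normalCone (h₁.subset (intrinsicInterior_subset hq₁))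
      (h₂.subset (intrinsicInterior_subset hq₂)) hn₁ hn₂
    exact hne' (h₁.eq_of_mem_intrinsicInterior h₂ hq₁ hq₂)
end
end

section
/- Brianchon–Gram theorem: Let P ⊂ ℝⁿ be a full-dimensional polytope, with facet representation P = {y ∈ ℝⁿ : ⟨y, u_F⟩ ≥ a_F for every facet F of P}, where u_F is the unit inward normal of the facet F and a_F ∈ ℝ. For each nonempty face Q of P, let T⁺_{P,Q} = {y ∈ ℝⁿ : ⟨y, u_F⟩ ≥ a_F for every facet F containing Q} be the inward tangent cone at Q (so T⁺_{P,P} = ℝⁿ). Then, as functions on ℝⁿ, 𝟙_P = Σ_{Q ⪯ P} (−1)^{dim Q} 𝟙_{T⁺_{P,Q}}, where the sum runs over all nonempty faces Q of P, including P itself. -/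
open Set MeasureTheory
open scoped RealInnerProductSpace BigOperators Classical Pointwise

noncomputable section

variable {n : ℕ}
/-- A polytope: the convex hull of a finite set. -/
def IsPolytope (P : Set (Euc n)) : Prop := ∃ S : Finset (Euc n), P = convexHull ℝ ↑S

/-- The dimension of a polytope/face: the dimension of the direction of its affine span. -/
def polyDim (Q : Set (Euc n)) : ℕ := Module.finrank ℝ (affineSpan ℝ Q).direction

/-- `F` is a facet of `P`: a face of dimension `n − 1`. -/
def IsFacet (P F : Set (Euc n)) : Prop := IsPolyFace P F ∧ polyDim F + 1 = n

/-- The inward tangent cone `T⁺_{P,Q} = {y : ⟪y, u_F⟫ ≥ a_F for every facet F ⊇ Q}`. -/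
def inwardTC (P : Set (Euc n)) (u : Set (Euc n) → Euc n) (a : Set (Euc n) → ℝ)
    (Q : Set (Euc n)) : Set (Euc n) :=
  {y | ∀ F, IsFacet P F → Q ⊆ F → a F ≤ ⟪y, u F⟫}

section EulerCharacteristic

open Filter Topology Module

variable {E : Type*} [NormedAddCommGroup E] [NormedSpace ℝ E]

/-- `A` spans the directions `D` and is algebraically open in them. -/
def IsRelOpenAlong (D : Submodule ℝ E) (A : Set E) : Prop :=
  ∀ y ∈ A, (∀ z ∈ A, z - y ∈ D) ∧ ∀ v ∈ D, ∃ ε : ℝ, 0 < ε ∧ y + ε • v ∈ A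

/-- The Euler characteristic of a nonempty bounded convex set that is compact or relatively
open. -/
inductive HasEulerWeight : Set E → ℝ → Prop
  | compact {A : Set E} : A.Nonempty → IsCompact A → Convex ℝ A → HasEulerWeight A 1
  | relOpen {A : Set E} {D : Submodule ℝ E} : A.Nonempty → Bornology.IsBounded A → Convex ℝ A →
      IsRelOpenAlong D A → HasEulerWeight A ((-1) ^ finrank ℝ D)

lemma HasEulerWeight.nonempty {A : Set E} {w : ℝ} (h : HasEulerWeight A w) : A.Nonempty := by
  cases h <;> assumption

/-- Linear combinations of indicator functions of subsets of `B`, paired with the corresponding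
combinations of Euler characteristics. -/
def eulerSpan (B : Set E) : Submodule ℝ ((E → ℝ) × ℝ) :=
  Submodule.span ℝ {q | ∃ A w, A ⊆ B ∧ HasEulerWeight A w ∧ q = (A.indicator (fun _ => 1), w)}

lemma HasEulerWeight.mem_eulerSpan {A B : Set E} {w : ℝ} (h : HasEulerWeight A w) (hAB : A ⊆ B) :
    (A.indicator (fun _ => 1), w) ∈ eulerSpan B :=
  Submodule.subset_span ⟨A, w, hAB, h, rfl⟩

/-- `c` is the sum of the right jumps of the step function `g`. -/
def HasJumpSum (g : ℝ → ℝ) (c : ℝ) : Prop :=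
  ∃ j : ℝ →₀ ℝ, (∀ t, ∀ᶠ s in 𝓝[>] t, g t - g s = j t) ∧
    Finsupp.linearCombination ℝ (fun _ => (1 : ℝ)) j = c

lemma HasJumpSum.zero : HasJumpSum 0 0 := ⟨0, by simp, by simp⟩

lemma HasJumpSum.add {g₁ g₂ : ℝ → ℝ} {c₁ c₂ : ℝ} (h₁ : HasJumpSum g₁ c₁) (h₂ : HasJumpSum g₂ c₂) :
    HasJumpSum (g₁ + g₂) (c₁ + c₂) := by
  obtain ⟨j₁, hj₁, rfl⟩ := h₁
  obtain ⟨j₂, hj₂, rfl⟩ := h₂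
  refine ⟨j₁ + j₂, fun t => ?_, map_add _ _ _⟩
  filter_upwards [hj₁ t, hj₂ t] with s h₁ h₂
  simp only [Pi.add_apply, Finsupp.add_apply, ← h₁, ← h₂]
  ring

lemma HasJumpSum.smul {g : ℝ → ℝ} {c : ℝ} (r : ℝ) (h : HasJumpSum g c) :
    HasJumpSum (r • g) (r • c) := by
  obtain ⟨j, hj, rfl⟩ := h
  refine ⟨r • j, fun t => ?_, map_smul _ _ _⟩
  filter_upwards [hj t] with s h
  simp only [Pi.smul_apply, Finsupp.smul_apply, ← h, smul_eq_mul]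
  ring

lemma HasJumpSum.eq_zero {c : ℝ} (h : HasJumpSum 0 c) : c = 0 := by
  obtain ⟨j, hj, rfl⟩ := h
  have : j = 0 := by
    ext t
    obtain ⟨s, hs⟩ := (hj t).exists
    simpa using hs.symm
  simp [this]

lemma hasJumpSum_Icc {a b : ℝ} (hab : a ≤ b) (w : ℝ) :
    HasJumpSum ((Icc a b).indicator fun _ => w) w := by
  refine ⟨Finsupp.single b w, fun t => ?_, by simp⟩
  rcases lt_or_ge t a with h | h
  · filter_upwards [Ioo_mem_nhdsGT h] with s hs
    have : b ≠ t := by linarith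
    simp [indicator, this, not_le.2 hs.2, not_le.2 h]
  rcases lt_trichotomy t b with h' | rfl | h'
  · filter_upwards [Ioo_mem_nhdsGT h'] with s hs
    simp [indicator, h'.ne', h, h'.le, hs.2.le, h.trans hs.1.le]
  · filter_upwards [self_mem_nhdsWithin] with s hs
    simp [indicator, h, not_le.2 (mem_Ioi.1 hs)]
  · filter_upwards [self_mem_nhdsWithin] with s hs
    simp [indicator, h'.ne, not_le.2 h', not_le.2 (h'.trans (mem_Ioi.1 hs))]

lemma hasJumpSum_Ioo {a b : ℝ} (hab : a < b) (w : ℝ) :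
    HasJumpSum ((Ioo a b).indicator fun _ => w) (-w) := by
  refine ⟨Finsupp.single a (-w), fun t => ?_, by simp⟩
  rcases lt_trichotomy t a with h | rfl | h
  · filter_upwards [Ioo_mem_nhdsGT h] with s hs
    simp [indicator, h.ne', hs.2.le, h.le, not_lt.2]
  · filter_upwards [Ioo_mem_nhdsGT hab] with s hs
    simp [indicator, hs.1, hs.2]
  rcases lt_or_ge t b with h' | h'
  · filter_upwards [Ioo_mem_nhdsGT h'] with s hs
    simp [indicator, h.ne, h, h', hs.2, h.trans hs.1]
  · filter_upwards [self_mem_nhdsWithin] with s hs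
    simp [indicator, h.ne, not_lt.2 h', not_lt.2 (h'.trans (mem_Ioi.1 hs).le)]

lemma IsRelOpenAlong.inter_level {D : Submodule ℝ E} {A : Set E} (hA : IsRelOpenAlong D A)
    (ℓ : E →ₗ[ℝ] ℝ) (t : ℝ) :
    IsRelOpenAlong (D ⊓ LinearMap.ker ℓ) (A ∩ {y | ℓ y = t}) := by
  rintro y ⟨hy, hyt⟩
  refine ⟨fun z hz => ⟨(hA y hy).1 z hz.1, ?_⟩, fun v hv => ?_⟩
  · simp_all
  · obtain ⟨ε, hε, h⟩ := (hA y hy).2 v hv.1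
    refine ⟨ε, hε, h, ?_⟩
    have : ℓ v = 0 := hv.2
    simp_all

lemma finrank_inf_ker_add_one [FiniteDimensional ℝ E] {D : Submodule ℝ E} {ℓ : E →ₗ[ℝ] ℝ} {v : E}
    (hv : v ∈ D) (hℓ : ℓ v ≠ 0) : finrank ℝ ↥(D ⊓ LinearMap.ker ℓ) + 1 = finrank ℝ D := by
  rw [← Submodule.finrank_sup_span_singleton (fun h : v ∈ D ⊓ LinearMap.ker ℓ => hℓ h.2)]
  suffices h : D ⊓ LinearMap.ker ℓ ⊔ Submodule.span ℝ {v} = D by rw [h]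
  refine le_antisymm (sup_le inf_le_left ((Submodule.span_singleton_le_iff_mem v D).2 hv))
    fun x hx => ?_
  refine Submodule.mem_sup.2 ⟨x - (ℓ x / ℓ v) • v, ⟨D.sub_mem hx (D.smul_mem _ hv), ?_⟩,
    (ℓ x / ℓ v) • v, Submodule.smul_mem _ _ (Submodule.mem_span_singleton_self v), by simp⟩
  simp [hℓ]

lemma convex_level (ℓ : E →ₗ[ℝ] ℝ) (t : ℝ) : Convex ℝ {y | ℓ y = t} :=
  (convex_singleton t).linear_preimage ℓ

lemma IsRelOpenAlong.image_eq_Ioo [FiniteDimensional ℝ E] {D : Submodule ℝ E} {A : Set E}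
    (hA : IsRelOpenAlong D A) (hne : A.Nonempty) (hb : Bornology.IsBounded A) (hc : Convex ℝ A)
    {ℓ : E →ₗ[ℝ] ℝ} {v : E} (hv : v ∈ D) (hℓ : 0 < ℓ v) : ∃ a b, a < b ∧ ℓ '' A = Ioo a b := by
  have hbdd : Bornology.IsBounded (ℓ '' A) :=
    (LinearMap.toContinuousLinearMap ℓ).lipschitz.isBounded_image hb
  have hconn : IsConnected (ℓ '' A) := ⟨hne.image ℓ, (hc.linear_image ℓ).isPreconnected⟩
  have hsub : ℓ '' A ⊆ Ioo (sInf (ℓ '' A)) (sSup (ℓ '' A)) := by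
    rintro _ ⟨y, hy, rfl⟩
    constructor
    · obtain ⟨ε, hε, h⟩ := (hA y hy).2 (-v) (D.neg_mem hv)
      have := csInf_le hbdd.bddBelow (mem_image_of_mem ℓ h)
      simp only [map_add, map_smul, map_neg, smul_eq_mul] at this
      nlinarith
    · obtain ⟨ε, hε, h⟩ := (hA y hy).2 v hv
      have := le_csSup hbdd.bddAbove (mem_image_of_mem ℓ h)
      simp only [map_add, map_smul, smul_eq_mul] at this
      nlinarith
  obtain ⟨y, hy⟩ := hne
  have := hsub (mem_image_of_mem ℓ hy)
  exact ⟨_, _, this.1.trans this.2,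
    hsub.antisymm (hconn.Ioo_csInf_csSup_subset hbdd.bddBelow hbdd.bddAbove)⟩

lemma HasEulerWeight.slices [FiniteDimensional ℝ E] {A : Set E} {w : ℝ} (h : HasEulerWeight A w)
    (ℓ : E →ₗ[ℝ] ℝ) : ∃ w' : ℝ, HasJumpSum ((ℓ '' A).indicator fun _ => w') w ∧
      ∀ t ∈ ℓ '' A, HasEulerWeight (A ∩ {y | ℓ y = t}) w' := by
  have hcont : Continuous ℓ := ℓ.continuous_of_finiteDimensional
  have hne : ∀ t ∈ ℓ '' A, (A ∩ {y | ℓ y = t}).Nonempty := by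
    rintro _ ⟨y, hy, rfl⟩
    exact ⟨y, hy, rfl⟩
  cases h with
  | compact hA hK hC =>
    refine ⟨1, ?_, fun t ht => .compact (hne t ht) (hK.inter_right
      (isClosed_eq hcont continuous_const)) (hC.inter (convex_level ℓ t))⟩
    have hI := eq_Icc_of_connected_compact ⟨hA.image ℓ, (hC.linear_image ℓ).isPreconnected⟩
      (hK.image hcont)
    have hI' := hA.image ℓ
    rw [hI] at hI' ⊢
    exact hasJumpSum_Icc (nonempty_Icc.1 hI') 1
  | @relOpen D hA hB hC hO =>
    refine ⟨(-1) ^ finrank ℝ ↥(D ⊓ LinearMap.ker ℓ), ?_, fun t ht => .relOpen (hne t ht)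
      (hB.subset inter_subset_left) (hC.inter (convex_level ℓ t)) (hO.inter_level ℓ t)⟩
    by_cases hD : D ≤ LinearMap.ker ℓ
    · obtain ⟨y, hy⟩ := hA
      have : ℓ '' A = Icc (ℓ y) (ℓ y) := by
        rw [Icc_self]
        refine subset_antisymm ?_ (singleton_subset_iff.2 ⟨y, hy, rfl⟩)
        rintro _ ⟨z, hz, rfl⟩
        have := hD ((hO y hy).1 z hz)
        rw [LinearMap.mem_ker, map_sub] at this
        exact sub_eq_zero.1 this
      rw [this, inf_eq_left.2 hD]
      exact hasJumpSum_Icc le_rfl _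
    · obtain ⟨v, hv, hℓ⟩ : ∃ v ∈ D, 0 < ℓ v := by
        obtain ⟨v, hv, hℓ⟩ := SetLike.not_le_iff_exists.1 hD
        rcases lt_or_gt_of_ne hℓ with h | h
        · exact ⟨-v, D.neg_mem hv, by simpa using h⟩
        · exact ⟨v, hv, h⟩
      obtain ⟨a, b, hab, hI⟩ := hO.image_eq_Ioo hA hB hC hv hℓ
      rw [hI, ← finrank_inf_ker_add_one hv hℓ.ne', pow_succ, mul_neg_one]
      exact hasJumpSum_Ioo hab _

lemma eulerSpan_slices [FiniteDimensional ℝ E] {B : Set E} (ℓ : E →ₗ[ℝ] ℝ) {q : (E → ℝ) × ℝ}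
    (hq : q ∈ eulerSpan B) : ∃ g : ℝ → ℝ, HasJumpSum g q.2 ∧
      ∀ t, ({y | ℓ y = t}.indicator q.1, g t) ∈ eulerSpan (B ∩ {y | ℓ y = t}) := by
  induction hq using Submodule.span_induction with
  | mem q hq =>
    obtain ⟨A, w, hAB, hA, rfl⟩ := hq
    obtain ⟨w', hj, hw'⟩ := hA.slices ℓ
    refine ⟨_, hj, fun t => ?_⟩
    rw [Set.indicator_indicator, inter_comm {y | ℓ y = t} A]
    by_cases ht : t ∈ ℓ '' A
    · rw [indicator_of_mem ht]
      exact (hw' t ht).mem_eulerSpan (inter_subset_inter_left _ hAB)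
    · have : A ∩ {y | ℓ y = t} = ∅ :=
        eq_empty_of_forall_notMem fun y hy => ht ⟨y, hy.1, hy.2⟩
      rw [indicator_of_notMem ht, this, indicator_empty]
      exact zero_mem _
  | zero => exact ⟨0, .zero, fun t => by simp [← Prod.zero_eq_mk]⟩
  | add q₁ q₂ _ _ h₁ h₂ =>
    obtain ⟨g₁, hg₁, h₁⟩ := h₁
    obtain ⟨g₂, hg₂, h₂⟩ := h₂
    refine ⟨g₁ + g₂, hg₁.add hg₂, fun t => ?_⟩
    simpa [indicator_add'] using add_mem (h₁ t) (h₂ t)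
  | smul r q _ h =>
    obtain ⟨g, hg, h⟩ := h
    refine ⟨r • g, hg.smul r, fun t => ?_⟩
    have hind : {y | ℓ y = t}.indicator (r • q.1) = r • {y | ℓ y = t}.indicator q.1 :=
      indicator_const_smul _ r q.1
    simpa [hind] using Submodule.smul_mem _ r (h t)

lemma eulerSpan_eq_of_subset_singleton {B : Set E} {p : E} (hB : B ⊆ {p}) {q : (E → ℝ) × ℝ}
    (hq : q ∈ eulerSpan B) : q.2 = q.1 p := by
  induction hq using Submodule.span_induction with
  | mem q hq =>
    obtain ⟨A, w, hAB, hA, rfl⟩ := hq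
    have hAp : A = {p} := (hA.nonempty.subset_singleton_iff).1 (hAB.trans hB)
    cases hA with
    | compact => simp [hAp]
    | @relOpen D _ _ _ hO =>
      have : D = ⊥ := by
        refine (Submodule.eq_bot_iff D).2 fun v hv => ?_
        obtain ⟨ε, hε, h⟩ := (hO p (by simp [hAp])).2 v hv
        simpa [hAp, hε.ne'] using h
      subst this
      simp [hAp]
  | zero => rfl
  | add q₁ q₂ _ _ h₁ h₂ => simp [h₁, h₂]
  | smul r q _ h => simp [h]

/-- The Euler characteristic of the zero function is well defined. -/
theorem eulerSpan_zero [FiniteDimensional ℝ E] (B : Set E) {c : ℝ}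
    (h : ((0 : E → ℝ), c) ∈ eulerSpan B) : c = 0 := by
  induction hm : finrank ℝ (vectorSpan ℝ B) using Nat.strong_induction_on generalizing B c with
  | _ m ih =>
  by_cases hB : ∃ p, B ⊆ {p}
  · obtain ⟨p, hp⟩ := hB
    simpa using eulerSpan_eq_of_subset_singleton hp h
  obtain ⟨p, hp⟩ : B.Nonempty := by
    by_contra hne
    exact hB ⟨0, by simp [not_nonempty_iff_eq_empty.1 hne]⟩
  obtain ⟨z, hz, hzp⟩ := not_subset.1 (not_exists.1 hB p)
  have hv : z - p ∈ vectorSpan ℝ B := vsub_mem_vectorSpan ℝ hz hp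
  obtain ⟨ℓ, hℓ, -⟩ := Submodule.exists_le_ker_of_notMem
    (p := (⊥ : Submodule ℝ E)) (v := z - p) (by simpa [sub_eq_zero] using hzp)
  obtain ⟨g, hg, hs⟩ := eulerSpan_slices ℓ h
  have hg0 : g = 0 := by
    ext t
    refine ih _ ?_ (B ∩ {y | ℓ y = t}) (by simpa using hs t) rfl
    rw [← hm, ← finrank_inf_ker_add_one hv hℓ, Nat.lt_succ_iff]
    refine Submodule.finrank_mono (le_inf (vectorSpan_mono ℝ inter_subset_left) ?_)
    refine Submodule.span_le.2 ?_
    rintro _ ⟨x, hx, y, hy, rfl⟩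
    have h₁ : ℓ x = t := hx.2
    have h₂ : ℓ y = t := hy.2
    simp [h₁, h₂]
  exact (hg0 ▸ hg).eq_zero

/-- The union of the open segments from `x` to the points of `A`. -/
def openJoin (x : E) (A : Set E) : Set E :=
  {z | ∃ y ∈ A, ∃ s : ℝ, 0 < s ∧ s < 1 ∧ z = x + s • (y - x)}

lemma Set.Nonempty.openJoin {A : Set E} (hA : A.Nonempty) (x : E) : (openJoin x A).Nonempty := by
  obtain ⟨y, hy⟩ := hA
  exact ⟨_, y, hy, 1 / 2, by norm_num, by norm_num, rfl⟩

lemma Convex.openJoin {A : Set E} (hA : Convex ℝ A) (x : E) : Convex ℝ (openJoin x A) := by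
  rintro _ ⟨y, hy, s, hs, hs', rfl⟩ _ ⟨z, hz, t, ht, ht', rfl⟩ a b ha hb hab
  obtain ⟨hpos, hlt⟩ : a * s + b * t ∈ Ioo 0 1 := convex_Ioo 0 1 ⟨hs, hs'⟩ ⟨ht, ht'⟩ ha hb hab
  refine ⟨(a * s / (a * s + b * t)) • y + (b * t / (a * s + b * t)) • z,
    hA hy hz (by positivity) (by positivity) (by field_simp), a * s + b * t, hpos, hlt, ?_⟩
  have hsum : (a * s + b * t) • ((a * s / (a * s + b * t)) • y + (b * t / (a * s + b * t)) • z) =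
      (a * s) • y + (b * t) • z := by
    rw [smul_add, smul_smul, smul_smul, mul_div_cancel₀ _ hpos.ne', mul_div_cancel₀ _ hpos.ne']
  obtain rfl : b = 1 - a := by linarith
  rw [smul_sub (a * s + (1 - a) * t), hsum]
  module

lemma IsRelOpenAlong.openJoin {D : Submodule ℝ E} {A : Set E} (hA : IsRelOpenAlong D A)
    (hc : Convex ℝ A) (x : E) {y₀ : E} (hy₀ : y₀ ∈ A) :
    IsRelOpenAlong (D ⊔ Submodule.span ℝ {y₀ - x}) (openJoin x A) := by
  have key : ∀ y ∈ A, ∀ c : ℝ, c • (y - x) ∈ D ⊔ Submodule.span ℝ {y₀ - x} := by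
    intro y hy c
    refine Submodule.smul_mem _ _ (Submodule.mem_sup.2 ⟨y - y₀, (hA y₀ hy₀).1 y hy, y₀ - x,
      Submodule.mem_span_singleton_self _, by abel⟩)
  rintro _ ⟨y, hy, s, hs, hs', rfl⟩
  refine ⟨?_, fun v hv => ?_⟩
  · rintro _ ⟨z, hz, t, -, -, rfl⟩
    simpa using sub_mem (key z hz t) (key y hy s)
  · obtain ⟨d', hd', e, he, rfl⟩ := Submodule.mem_sup.1 hv
    obtain ⟨c, rfl⟩ := Submodule.mem_span_singleton.1 he
    set d := d' - c • (y - y₀) with hd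
    have hdD : d ∈ D := D.sub_mem hd' (D.smul_mem _ ((hA y₀ hy₀).1 y hy))
    obtain ⟨η, hη, hyη⟩ := (hA y hy).2 d hdD
    have hlim : Tendsto (fun ε : ℝ => s + ε * c) (𝓝[>] 0) (𝓝 s) := by
      have : Continuous fun ε : ℝ => s + ε * c := by fun_prop
      simpa using (this.tendsto 0).mono_left nhdsWithin_le_nhds
    obtain ⟨ε, ⟨h₁, h₂⟩, hε, hε'⟩ := ((hlim.eventually (Ioo_mem_nhds (half_lt_self hs) hs')).and
      (Ioo_mem_nhdsGT (show (0 : ℝ) < η * (s / 2) by positivity))).exists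
    have hsε : 0 < s + ε * c := by linarith
    refine ⟨ε, hε, y + (ε / (s + ε * c)) • d, ?_, s + ε * c, hsε, h₂, ?_⟩
    · have hle : ε / (s + ε * c) / η ≤ 1 := by
        rw [div_div, div_le_one (by positivity)]
        nlinarith
      have := hc.add_smul_mem hy hyη (t := ε / (s + ε * c) / η) ⟨by positivity, hle⟩
      rwa [smul_smul, div_mul_cancel₀ _ hη.ne'] at this
    · have : (s + ε * c) • (y + (ε / (s + ε * c)) • d - x) = (s + ε * c) • (y - x) + ε • d := by
        rw [add_sub_right_comm, smul_add, smul_smul, mul_div_cancel₀ _ hsε.ne']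
      rw [this, hd]
      module

lemma HasEulerWeight.openJoin [FiniteDimensional ℝ E] {D : Submodule ℝ E} {A : Set E}
    (hA : IsRelOpenAlong D A) (hne : A.Nonempty) (hc : Convex ℝ A) {x : E}
    (hx : ∀ y ∈ A, y - x ∉ D) (hb : Bornology.IsBounded (openJoin x A)) :
    HasEulerWeight (openJoin x A) (-(-1) ^ finrank ℝ D) := by
  obtain ⟨y, hy⟩ := hne
  have := HasEulerWeight.relOpen (Set.Nonempty.openJoin ⟨y, hy⟩ x) hb (hc.openJoin x)
    (hA.openJoin hc x hy)
  rwa [Submodule.finrank_sup_span_singleton (hx y hy), pow_succ, mul_neg_one] at this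

lemma mem_convexJoin_singleton {x z : E} {P : Set E} :
    z ∈ convexJoin ℝ {x} P ↔ ∃ y ∈ P, ∃ s : ℝ, 0 ≤ s ∧ s ≤ 1 ∧ z = x + s • (y - x) := by
  simp only [mem_convexJoin, mem_singleton_iff, exists_eq_left, segment_eq_image', mem_image,
    mem_Icc, and_assoc, eq_comm (a := z)]

lemma IsCompact.convexJoin_singleton {P : Set E} (hP : IsCompact P) (x : E) :
    IsCompact (convexJoin ℝ {x} P) := by
  have : convexJoin ℝ {x} P = (fun p : ℝ × E => x + p.1 • (p.2 - x)) '' (Icc 0 1 ×ˢ P) := by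
    ext z
    rw [mem_convexJoin_singleton]
    constructor
    · rintro ⟨y, hy, s, hs, hs', rfl⟩
      exact ⟨(s, y), ⟨⟨hs, hs'⟩, hy⟩, rfl⟩
    · rintro ⟨⟨s, y⟩, ⟨⟨hs, hs'⟩, hy⟩, rfl⟩
      exact ⟨y, hy, s, hs, hs', rfl⟩
  rw [this]
  exact (isCompact_Icc.prod hP).image (by fun_prop)

lemma openJoin_subset_convexJoin {x : E} {A P : Set E} (h : A ⊆ P) :
    openJoin x A ⊆ convexJoin ℝ {x} P := by
  rintro z ⟨y, hy, s, hs, hs', rfl⟩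
  exact mem_convexJoin_singleton.2 ⟨y, h hy, s, hs.le, hs'.le, rfl⟩

lemma sum_mem_eulerSpan {κ : Type*} {s : Finset κ} {A : κ → Set E} {w : κ → ℝ} {B : Set E}
    (h : ∀ k ∈ s, A k ⊆ B ∧ HasEulerWeight (A k) (w k)) :
    (fun z => ∑ k ∈ s, (A k).indicator (fun _ => 1) z, ∑ k ∈ s, w k) ∈ eulerSpan B := by
  have := sum_mem fun k hk => (h k hk).2.mem_eulerSpan (h k hk).1
  convert this using 1
  ext <;> simp [Prod.fst_sum, Prod.snd_sum]

lemma eulerSpan_unique [FiniteDimensional ℝ E] {B : Set E} {p q : (E → ℝ) × ℝ}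
    (hp : p ∈ eulerSpan B) (hq : q ∈ eulerSpan B) (h : ∀ z, p.1 z = q.1 z) : p.2 = q.2 := by
  refine sub_eq_zero.1 (eulerSpan_zero B ?_)
  have h' : p.1 - q.1 = 0 := sub_eq_zero.2 (funext h)
  have := sub_mem hp hq
  rwa [← Prod.mk.eta (p := p - q), Prod.fst_sub, Prod.snd_sub, h'] at this

end EulerCharacteristic

lemma sum_indicator_eq_one {κ E : Type*} {s : Finset κ} {A : κ → Set E} {z : E} {k : κ} (hk : k ∈ s)
    (hz : z ∈ A k) (h : ∀ l ∈ s, z ∈ A l → l = k) :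
    ∑ l ∈ s, (A l).indicator (fun _ => (1 : ℝ)) z = 1 := by
  rw [Finset.sum_eq_single_of_mem k hk, indicator_of_mem hz]
  exact fun l hl hlk => indicator_of_notMem (fun hzl => hlk (h l hl hzl)) _

lemma sum_indicator_eq_zero {κ E : Type*} {s : Finset κ} {A : κ → Set E} {z : E}
    (h : ∀ l ∈ s, z ∉ A l) : ∑ l ∈ s, (A l).indicator (fun _ => (1 : ℝ)) z = 0 :=
  Finset.sum_eq_zero fun l hl => indicator_of_notMem (h l hl) _

section Polyhedron

open Filter Topology Module

variable {E ι : Type*} [NormedAddCommGroup E] [NormedSpace ℝ E]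

/-- The polyhedron cut out by the inequalities `a i ≤ f i y`. -/
def polyhedron (f : ι → E →ₗ[ℝ] ℝ) (a : ι → ℝ) : Set E := {y | ∀ i, a i ≤ f i y}

/-- The points of the polyhedron at which exactly the inequalities in `I` are equalities. -/
def stratum (f : ι → E →ₗ[ℝ] ℝ) (a : ι → ℝ) (I : Set ι) : Set E :=
  {y | (∀ i ∈ I, f i y = a i) ∧ ∀ i ∉ I, a i < f i y}

/-- The common kernel of the functionals indexed by `I`. -/
def commonKer (f : ι → E →ₗ[ℝ] ℝ) (I : Set ι) : Submodule ℝ E := ⨅ i ∈ I, LinearMap.ker (f i)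

variable {f : ι → E →ₗ[ℝ] ℝ} {a : ι → ℝ} {I J : Set ι} {x y z : E}

lemma mem_commonKer {v : E} : v ∈ commonKer f I ↔ ∀ i ∈ I, f i v = 0 := by
  simp [commonKer, Submodule.mem_iInf]

lemma stratum_subset_polyhedron : stratum f a I ⊆ polyhedron f a := by
  intro y hy i
  by_cases hi : i ∈ I
  · exact (hy.1 i hi).ge
  · exact (hy.2 i hi).le

lemma eq_of_mem_stratum (hy : y ∈ stratum f a I) : I = {i | f i y = a i} := by
  ext i
  exact ⟨hy.1 i, fun h => by_contra fun hi => (hy.2 i hi).ne' h⟩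

lemma mem_stratum_active (hy : y ∈ polyhedron f a) : y ∈ stratum f a {i | f i y = a i} :=
  ⟨fun _ h => h, fun i hi => lt_of_le_of_ne (hy i) (Ne.symm hi)⟩

lemma convex_polyhedron : Convex ℝ (polyhedron f a) := by
  have : polyhedron f a = ⋂ i, f i ⁻¹' Ici (a i) := by
    ext; simp [polyhedron]
  rw [this]
  exact convex_iInter fun i => (convex_Ici _).linear_preimage _

lemma convex_stratum : Convex ℝ (stratum f a I) := by
  have : stratum f a I = (⋂ i ∈ I, f i ⁻¹' {a i}) ∩ ⋂ i ∈ Iᶜ, f i ⁻¹' Ioi (a i) := by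
    ext; simp [stratum]
  rw [this]
  exact (convex_iInter₂ fun i _ => (convex_singleton _).linear_preimage _).inter
    (convex_iInter₂ fun i _ => (convex_Ioi _).linear_preimage _)

lemma eventually_strict [Finite ι] (f : ι → E →ₗ[ℝ] ℝ) (a : ι → ℝ) (y v : E) :
    ∀ᶠ ε : ℝ in 𝓝[>] 0, ∀ i, a i < f i y → a i < f i (y + ε • v) := by
  refine eventually_all.2 fun i => ?_
  by_cases h : a i < f i y
  · have hc : Continuous fun ε : ℝ => f i y + ε * f i v := by fun_prop
    filter_upwards [((hc.tendsto' 0 (f i y) (by simp)).mono_left nhdsWithin_le_nhds).eventually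
      (lt_mem_nhds h)] with ε hε _
    simpa using hε
  · simp [h]

/-- From a point of the polyhedron one can move a little in every direction along which no active
constraint decreases. -/
lemma eventually_mem_polyhedron [Finite ι] {v : E} (hy : y ∈ polyhedron f a)
    (hv : ∀ i, f i y = a i → 0 ≤ f i v) : ∀ᶠ ε : ℝ in 𝓝[>] 0, y + ε • v ∈ polyhedron f a := by
  filter_upwards [eventually_strict f a y v, self_mem_nhdsWithin] with ε h hε i
  rcases (hy i).eq_or_lt with hi | hi
  · have := mul_nonneg (le_of_lt hε) (hv i hi.symm)
    simp only [map_add, map_smul, smul_eq_mul]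
    linarith
  · exact (h i hi).le

lemma isRelOpenAlong_stratum [Finite ι] : IsRelOpenAlong (commonKer f I) (stratum f a I) := by
  intro y hy
  refine ⟨fun z hz => mem_commonKer.2 fun i hi => by simp [hy.1 i hi, hz.1 i hi], fun v hv => ?_⟩
  obtain ⟨ε, h, hε⟩ := ((eventually_strict f a y v).and self_mem_nhdsWithin).exists
  refine ⟨ε, hε, fun i hi => ?_, fun i hi => h i (hy.2 i hi)⟩
  simp [hy.1 i hi, mem_commonKer.1 hv i hi]

/-- The points of the polyhedron at which at least the inequalities in `I` are equalities. -/
def closedFace (f : ι → E →ₗ[ℝ] ℝ) (a : ι → ℝ) (I : Set ι) : Set E :=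
  {y | y ∈ polyhedron f a ∧ ∀ i ∈ I, f i y = a i}

lemma stratum_subset_closedFace : stratum f a I ⊆ closedFace f a I :=
  fun _ hy => ⟨stratum_subset_polyhedron hy, hy.1⟩

lemma subset_of_closedFace_subset (hI : (stratum f a I).Nonempty)
    (h : closedFace f a I ⊆ closedFace f a J) : J ⊆ I := by
  obtain ⟨y, hy⟩ := hI
  rw [eq_of_mem_stratum hy]
  exact (h (stratum_subset_closedFace hy)).2

lemma vectorSpan_closedFace [Finite ι] (hI : (stratum f a I).Nonempty) :
    vectorSpan ℝ (closedFace f a I) = commonKer f I := by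
  refine le_antisymm (Submodule.span_le.2 ?_) fun v hv => ?_
  · rintro _ ⟨y, hy, z, hz, rfl⟩
    exact mem_commonKer.2 fun i hi => by simp [hy.2 i hi, hz.2 i hi]
  · obtain ⟨y, hy⟩ := hI
    obtain ⟨ε, hε, h⟩ := (isRelOpenAlong_stratum y hy).2 v hv
    have := vsub_mem_vectorSpan ℝ (stratum_subset_closedFace h) (stratum_subset_closedFace hy)
    rw [vsub_eq_sub, add_sub_cancel_left] at this
    exact (Submodule.smul_mem_iff _ hε.ne').1 this

/-- Every nonempty set of maximizers of a linear functional on a polyhedron is a closed face. -/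
lemma exists_eq_closedFace [Finite ι] {g : E →ₗ[ℝ] ℝ} {r : ℝ} (hg : ∀ y ∈ polyhedron f a, g y ≤ r)
    (hne : {y ∈ polyhedron f a | g y = r}.Nonempty) :
    ∃ I, (stratum f a I).Nonempty ∧ closedFace f a I = {y ∈ polyhedron f a | g y = r} := by
  obtain ⟨_, ⟨y, ⟨hy, hgy⟩, rfl⟩, hmin⟩ := (Set.toFinite
    ((fun y => {i | f i y = a i}) '' {y ∈ polyhedron f a | g y = r})).exists_minimal (hne.image _)
  refine ⟨{i | f i y = a i}, ⟨y, mem_stratum_active hy⟩, Subset.antisymm ?_ ?_⟩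
  · rintro z ⟨hz, hzI⟩
    refine ⟨hz, le_antisymm (hg z hz) ?_⟩
    obtain ⟨ε, h, hε⟩ := ((eventually_mem_polyhedron (v := y - z) hy fun i hi => by
      simp [hi, hzI i hi]).and self_mem_nhdsWithin).exists
    have := hg _ h
    simp only [map_add, map_smul, map_sub, smul_eq_mul, hgy] at this
    have hε : 0 < ε := hε
    nlinarith
  · rintro z ⟨hz, hgz⟩
    refine ⟨hz, fun i hi => ?_⟩
    have hmid : midpoint ℝ y z ∈ polyhedron f a := convex_polyhedron.midpoint_mem hy hz
    have hval (h : E →ₗ[ℝ] ℝ) : h (midpoint ℝ y z) = (h y + h z) / 2 := by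
      rw [midpoint_eq_smul_add]
      simp only [map_smul, map_add, invOf_eq_inv, smul_eq_mul]
      ring
    have hle : {i | f i (midpoint ℝ y z) = a i} ≤ {i | f i y = a i} := fun j hj => by
      have hj : f j (midpoint ℝ y z) = a j := hj
      rw [hval] at hj
      have h₁ := hy j
      have h₂ := hz j
      exact le_antisymm (by linarith) h₁
    have hi' : f i (midpoint ℝ y z) = a i :=
      hmin ⟨_, ⟨hmid, by rw [hval, hgy, hgz]; ring⟩, rfl⟩ hle hi
    have hi : f i y = a i := hi
    rw [hval] at hi'
    linarith

lemma notMem_polyhedron_of_visible {i : ι} (hy : f i y = a i) (hx : f i x < a i) {s : ℝ}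
    (hs : s < 1) : x + s • (y - x) ∉ polyhedron f a := by
  intro h
  have := h i
  simp only [map_add, map_smul, map_sub, smul_eq_mul, hy] at this
  nlinarith

/-- Every segment from a point outside the polyhedron to a point of the polyhedron enters the
polyhedron through a visible point. -/
lemma exists_visible_point [Finite ι] (hP : IsCompact (polyhedron f a)) (hx : x ∉ polyhedron f a)
    (hz : z ∈ convexJoin ℝ {x} (polyhedron f a)) (hzP : z ∉ polyhedron f a) (hzx : z ≠ x) :
    ∃ y ∈ polyhedron f a, (∃ i, f i y = a i ∧ f i x < a i) ∧
      ∃ s : ℝ, 0 < s ∧ s < 1 ∧ z = x + s • (y - x) := by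
  obtain ⟨y, hy, s, hs, hs', rfl⟩ := mem_convexJoin_singleton.1 hz
  let γ : ℝ → E := fun τ => x + τ • (y - x)
  have hγ : Continuous γ := by fun_prop
  obtain ⟨τ, ⟨⟨hτ, hτ'⟩, hτP⟩, hmin⟩ := (isCompact_Icc.inter_right
    (hP.isClosed.preimage hγ)).exists_isLeast (s := Icc (0 : ℝ) 1 ∩ γ ⁻¹' polyhedron f a)
    ⟨1, ⟨zero_le_one, le_rfl⟩, by simpa [γ] using hy⟩
  have hs0 : 0 < s := lt_of_le_of_ne hs (by rintro rfl; simp at hzx)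
  have hτ0 : 0 < τ := lt_of_le_of_ne hτ (by rintro rfl; simp [γ, hx] at hτP)
  have hsτ : s < τ := by
    by_contra! h
    have hτ1 : τ < 1 := by
      refine lt_of_le_of_ne hτ' ?_
      rintro rfl
      obtain rfl : s = 1 := le_antisymm hs' h
      exact hzP hτP
    have hconv : Convex ℝ (γ ⁻¹' polyhedron f a) := by
      have : γ = AffineMap.lineMap x y := by
        ext t
        simp [γ, AffineMap.lineMap_apply, add_comm]
      rw [this]
      exact convex_polyhedron.affine_preimage _
    exact hzP (hconv.ordConnected.out hτP (by simpa [γ] using hy) ⟨h, hs'⟩)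
  refine ⟨γ τ, hτP, ?_, s / τ, by positivity, (div_lt_one hτ0).2 hsτ, ?_⟩
  · by_contra! hvis
    obtain ⟨ε, hε, hε0, hε1⟩ := ((eventually_mem_polyhedron (v := x - γ τ) hτP fun i hi => by
      simpa [hi] using hvis i hi).and (Ioo_mem_nhdsGT zero_lt_one)).exists
    have heq : γ τ + ε • (x - γ τ) = γ ((1 - ε) * τ) := by
      simp only [γ]
      module
    rw [heq] at hε
    have := hmin ⟨⟨by nlinarith, by nlinarith⟩, hε⟩
    nlinarith
  · simp only [γ, add_sub_cancel_left, smul_smul, div_mul_cancel₀ _ hτ0.ne']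

lemma eq_of_visible {y' : E} {i i' : ι} (hy : y ∈ polyhedron f a) (hy' : y' ∈ polyhedron f a)
    (hi : f i y = a i) (hxi : f i x < a i) (hi' : f i' y' = a i') (hxi' : f i' x < a i') {s s' : ℝ}
    (hs : 0 < s) (hs' : 0 < s') (h : x + s • (y - x) = x + s' • (y' - x)) : y = y' := by
  have h' : s • (y - x) = s' • (y' - x) := add_left_cancel h
  rcases lt_trichotomy s s' with hlt | rfl | hlt
  · refine absurd ?_ (notMem_polyhedron_of_visible hi hxi ((div_lt_one hs').2 hlt))
    rwa [div_eq_inv_mul, mul_smul, h', inv_smul_smul₀ hs'.ne', add_sub_cancel]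
  · simpa using smul_right_injective E hs.ne' h'
  · refine absurd ?_ (notMem_polyhedron_of_visible hi' hxi' ((div_lt_one hs).2 hlt))
    rwa [div_eq_inv_mul, mul_smul, ← h', inv_smul_smul₀ hs.ne', add_sub_cancel]

lemma closedFace_eq_exposed [Fintype ι] (f : ι → E →ₗ[ℝ] ℝ) (a : ι → ℝ) (I : Set ι) :
    closedFace f a I = {y ∈ polyhedron f a | ∑ i with i ∈ I, f i y = ∑ i with i ∈ I, a i} := by
  ext y
  refine and_congr_right fun hy => ?_
  rw [eq_comm (b := ∑ i with i ∈ I, a i), Finset.sum_eq_sum_iff_of_le fun i _ => hy i]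
  simp [eq_comm]

variable [Fintype ι] [FiniteDimensional ℝ E]

lemma sum_strata_eulerWeight (hP : IsCompact (polyhedron f a)) (hne : (polyhedron f a).Nonempty) :
    ∑ I : Set ι with (stratum f a I).Nonempty, (-1 : ℝ) ^ finrank ℝ (commonKer f I) = 1 := by
  refine eulerSpan_unique (sum_mem_eulerSpan (A := stratum f a) (B := univ) fun I hI =>
    ⟨subset_univ _, .relOpen (Finset.mem_filter.1 hI).2
      (hP.isBounded.subset stratum_subset_polyhedron) convex_stratum isRelOpenAlong_stratum⟩)
    ((HasEulerWeight.compact hne hP convex_polyhedron).mem_eulerSpan (subset_univ _)) fun z => ?_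
  by_cases hz : z ∈ polyhedron f a
  · simp only [indicator_of_mem hz]
    exact sum_indicator_eq_one (by simpa using ⟨z, mem_stratum_active hz⟩) (mem_stratum_active hz)
      fun I _ hI => eq_of_mem_stratum hI
  · simp only [indicator_of_notMem hz]
    exact sum_indicator_eq_zero fun I _ hI => hz (stratum_subset_polyhedron hI)

lemma sum_visible_strata_eulerWeight (hP : IsCompact (polyhedron f a))
    (hne : (polyhedron f a).Nonempty) (hx : x ∉ polyhedron f a) :
    ∑ I : Set ι with (stratum f a I).Nonempty ∧ ∃ i ∈ I, f i x < a i,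
      (-1 : ℝ) ^ finrank ℝ (commonKer f I) = 1 := by
  set s : Finset (Set ι) := {I | (stratum f a I).Nonempty ∧ ∃ i ∈ I, f i x < a i} with hs
  have hK := hP.convexJoin_singleton x
  have hsub (I : Set ι) : openJoin x (stratum f a I) ⊆ convexJoin ℝ {x} (polyhedron f a) :=
    openJoin_subset_convexJoin stratum_subset_polyhedron
  have hsum := sum_mem_eulerSpan (s := s) (A := fun I => openJoin x (stratum f a I))
    (w := fun I => -(-1) ^ finrank ℝ (commonKer f I)) (B := univ) fun I hI => by
      obtain ⟨hne, i, hi, hxi⟩ := (Finset.mem_filter.1 hI).2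
      refine ⟨subset_univ _, .openJoin isRelOpenAlong_stratum hne convex_stratum ?_
        (hK.isBounded.subset (hsub I))⟩
      intro y hy h
      have := mem_commonKer.1 h i hi
      rw [map_sub, hy.1 i hi] at this
      linarith
  have hxmem : x ∈ convexJoin ℝ {x} (polyhedron f a) := by
    obtain ⟨y, hy⟩ := hne
    exact mem_convexJoin_singleton.2 ⟨y, hy, 0, le_rfl, zero_le_one, by simp⟩
  have hjoin : HasEulerWeight (convexJoin ℝ {x} (polyhedron f a)) 1 :=
    .compact ⟨x, hxmem⟩ hK ((convex_singleton x).convexJoin convex_polyhedron)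
  have hpt : HasEulerWeight {x} 1 :=
    .compact (singleton_nonempty x) isCompact_singleton (convex_singleton x)
  have key := eulerSpan_unique (hjoin.mem_eulerSpan (subset_univ _))
    (add_mem (add_mem ((HasEulerWeight.compact hne hP convex_polyhedron).mem_eulerSpan
      (subset_univ _)) (hpt.mem_eulerSpan (subset_univ _))) hsum) fun z => ?_
  · simp only [Prod.snd_add, Finset.sum_neg_distrib] at key
    linarith
  simp only [Prod.fst_add, Pi.add_apply]
  by_cases hzP : z ∈ polyhedron f a
  · have hzx : z ≠ x := by rintro rfl; exact hx hzP
    have hzK : z ∈ convexJoin ℝ {x} (polyhedron f a) :=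
      mem_convexJoin_singleton.2 ⟨z, hzP, 1, zero_le_one, le_rfl, by simp⟩
    rw [indicator_of_mem hzK, sum_indicator_eq_zero]
    · simp [hzP, hzx]
    rintro I hI ⟨y, hy, t, ht, ht', rfl⟩
    obtain ⟨-, i, hi, hxi⟩ := (Finset.mem_filter.1 hI).2
    exact notMem_polyhedron_of_visible (hy.1 i hi) hxi ht' hzP
  by_cases hzx : z = x
  · subst hzx
    rw [indicator_of_mem hxmem, sum_indicator_eq_zero]
    · simp [hx]
    rintro I hI ⟨y, hy, t, ht, ht', h⟩
    have : z = y := by simpa [ht.ne', sub_eq_zero, eq_comm] using h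
    exact hx (this ▸ stratum_subset_polyhedron hy)
  by_cases hzK : z ∈ convexJoin ℝ {x} (polyhedron f a)
  · obtain ⟨y, hy, ⟨i, hi, hxi⟩, t, ht, ht', rfl⟩ := exists_visible_point hP hx hzK hzP hzx
    rw [indicator_of_mem hzK, sum_indicator_eq_one (k := {i | f i y = a i})]
    · simp [hzP, hzx]
    · simp only [hs, Finset.mem_filter, Finset.mem_univ, true_and]
      exact ⟨⟨y, mem_stratum_active hy⟩, i, hi, hxi⟩
    · exact ⟨y, mem_stratum_active hy, t, ht, ht', rfl⟩
    · rintro I hI ⟨y', hy', t', ht₁, ht₂, h⟩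
      obtain ⟨-, j, hj, hxj⟩ := (Finset.mem_filter.1 hI).2
      obtain rfl := eq_of_visible hy (stratum_subset_polyhedron hy') hi hxi (hy'.1 j hj) hxj ht ht₁ h
      exact eq_of_mem_stratum hy'
  · rw [indicator_of_notMem hzK, sum_indicator_eq_zero fun I _ h => hzK (hsub I h)]
    simp [hzP, hzx]

/-- The Brianchon–Gram relation for a bounded polyhedron, indexed by the sets of constraints that
are active on the strata. -/
theorem sum_strata_tangentCone (hP : IsCompact (polyhedron f a)) (hne : (polyhedron f a).Nonempty)
    (x : E) :
    ∑ I : Set ι with (stratum f a I).Nonempty, (-1 : ℝ) ^ finrank ℝ (commonKer f I) *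
      {y | ∀ i ∈ I, a i ≤ f i y}.indicator (fun _ => (1 : ℝ)) x =
    (polyhedron f a).indicator (fun _ => 1) x := by
  by_cases hx : x ∈ polyhedron f a
  · rw [indicator_of_mem hx]
    refine (Finset.sum_congr rfl fun I _ => ?_).trans (sum_strata_eulerWeight hP hne)
    rw [indicator_of_mem (show x ∈ {y | ∀ i ∈ I, a i ≤ f i y} from fun i _ => hx i), mul_one]
  · have h := sum_strata_eulerWeight hP hne
    rw [← Finset.sum_filter_add_sum_filter_not _ (fun I : Set ι => ∃ i ∈ I, f i x < a i),
      Finset.filter_filter, sum_visible_strata_eulerWeight hP hne hx, add_eq_left,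
      Finset.sum_filter] at h
    rw [indicator_of_notMem hx, ← h]
    refine Finset.sum_congr rfl fun I _ => ?_
    simp [indicator]

end Polyhedron

lemma isPolyFace_nonempty_iff {ι : Type*} [Fintype ι] {v : ι → Euc n} {a : ι → ℝ}
    {f : ι → Euc n →ₗ[ℝ] ℝ} (hf : ∀ i y, f i y = ⟪y, v i⟫) {Q : Set (Euc n)}
    (hne : (polyhedron f a).Nonempty) :
    (IsPolyFace (polyhedron f a) Q ∧ Q.Nonempty) ↔
      ∃ I, (stratum f a I).Nonempty ∧ closedFace f a I = Q := by
  constructor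
  · rintro ⟨rfl | ⟨w, -, r, hw, rfl⟩, hQ⟩
    · simpa using exists_eq_closedFace (g := 0) (r := 0) (by simp) (by simpa using hne)
    · exact exists_eq_closedFace (g := (innerₗ (Euc n)).flip w) hw hQ
  · rintro ⟨I, hI, rfl⟩
    refine ⟨?_, hI.mono stratum_subset_closedFace⟩
    obtain ⟨z, hz⟩ := hI.mono stratum_subset_closedFace
    have key (y : Euc n) : ⟪y, -∑ i with i ∈ I, v i⟫ = -∑ i with i ∈ I, f i y := by
      simp [inner_neg_right, inner_sum, hf]
    rw [closedFace_eq_exposed] at hz ⊢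
    by_cases hw : -∑ i with i ∈ I, v i = 0
    · left
      have hsum (y : Euc n) : ∑ i with i ∈ I, f i y = 0 := by
        simpa [hw] using (key y).symm
      have ha := hz.2
      rw [hsum] at ha
      simp [hsum, ← ha]
    · refine Or.inr ⟨_, hw, -∑ i with i ∈ I, a i, fun y hy => ?_, ?_⟩
      · rw [key, neg_le_neg_iff]
        exact Finset.sum_le_sum fun i _ => hy i
      · simp only [key, neg_inj]

/-- **Brianchon–Gram theorem.** For a full-dimensional polytope `P ⊂ ℝⁿ` with facet
representation `P = {y : ⟪y, u_F⟫ ≥ a_F for all facets F}` (unit inward normals `u_F`),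
`𝟙_P = Σ_{Q ⪯ P} (−1)^{dim Q} 𝟙_{T⁺_{P,Q}}`, the sum running over the nonempty faces of `P`. -/
theorem brianchon_gram {n : ℕ} (P : Set (Euc n)) (hP : IsPolytope P)
    (hfull : affineSpan ℝ P = ⊤)
    (u : Set (Euc n) → Euc n) (a : Set (Euc n) → ℝ)
    (hu : ∀ F, IsFacet P F → ‖u F‖ = 1 ∧ (∀ y ∈ P, a F ≤ ⟪y, u F⟫) ∧
        F = {y | y ∈ P ∧ ⟪y, u F⟫ = a F})
    (hrep : P = {y | ∀ F, IsFacet P F → a F ≤ ⟪y, u F⟫})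
    (hfin : {Q | IsPolyFace P Q ∧ Q.Nonempty}.Finite) :
    ∀ x : Euc n,
      P.indicator (fun _ => (1 : ℝ)) x =
        ∑ Q ∈ hfin.toFinset, (-1 : ℝ) ^ polyDim Q *
          (inwardTC P u a Q).indicator (fun _ => (1 : ℝ)) x := by
  intro x
  have hfacets : {F | IsFacet P F}.Finite := by
    refine (hfin.insert ∅).subset fun F hF => ?_
    rcases F.eq_empty_or_nonempty with rfl | hne
    · exact mem_insert _ _
    · exact mem_insert_of_mem _ ⟨hF.1, hne⟩
  have : Fintype {F // IsFacet P F} := hfacets.fintype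
  let f : {F // IsFacet P F} → Euc n →ₗ[ℝ] ℝ := fun F => (innerₗ (Euc n)).flip (u F)
  let b : {F // IsFacet P F} → ℝ := fun F => a F
  have hPf : P = polyhedron f b := by
    refine hrep.trans ?_
    ext y
    exact ⟨fun h F => h F F.2, fun h F hF => h ⟨F, hF⟩⟩
  have hne : (polyhedron f b).Nonempty := by
    rw [← hPf, ← affineSpan_nonempty ℝ, hfull]
    exact ⟨0, trivial⟩
  have hcompact : IsCompact (polyhedron f b) := by
    obtain ⟨S, hS⟩ := hP
    rw [← hPf, hS]
    exact S.finite_toSet.isCompact_convexHull ℝ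
  have hface (Q : Set (Euc n)) : (IsPolyFace P Q ∧ Q.Nonempty) ↔
      ∃ I, (stratum f b I).Nonempty ∧ closedFace f b I = Q := by
    have := isPolyFace_nonempty_iff (Q := Q) (f := f) (v := fun F : {F // IsFacet P F} => u F)
      (fun _ _ => rfl) hne
    rwa [← hPf] at this
  have hcone {I : Set {F // IsFacet P F}} (hI : (stratum f b I).Nonempty) :
      inwardTC P u a (closedFace f b I) = {y | ∀ F ∈ I, b F ≤ f F y} := by
    have hsub (F : {F // IsFacet P F}) : closedFace f b I ⊆ F ↔ F ∈ I := by
      have hF : (F : Set (Euc n)) = closedFace f b {F} := by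
        rw [(hu F F.2).2.2]
        simp only [closedFace, ← hPf, mem_singleton_iff, forall_eq]
        rfl
      rw [hF]
      refine ⟨fun h => subset_of_closedFace_subset hI h rfl, fun h y hy => ⟨hy.1, ?_⟩⟩
      rintro _ rfl
      exact hy.2 _ h
    ext y
    exact ⟨fun h F hF => h F F.2 ((hsub F).2 hF), fun h F hF hQ => h ⟨F, hF⟩ ((hsub ⟨F, hF⟩).1 hQ)⟩
  have hmain := sum_strata_tangentCone hcompact hne x
  rw [← hPf] at hmain
  rw [← hmain]
  refine Finset.sum_nbij (closedFace f b) (fun I hI => ?_) (fun I hI J hJ hIJ => ?_)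
    (fun Q hQ => ?_) (fun I hI => ?_)
  · exact hfin.mem_toFinset.2 ((hface _).2 ⟨I, (Finset.mem_filter.1 hI).2, rfl⟩)
  · exact (subset_of_closedFace_subset (Finset.mem_filter.1 hJ).2 hIJ.ge).antisymm
      (subset_of_closedFace_subset (Finset.mem_filter.1 hI).2 hIJ.le)
  · obtain ⟨I, hI, rfl⟩ := (hface Q).1 (hfin.mem_toFinset.1 hQ)
    exact ⟨I, by simpa using hI, rfl⟩
  · have hI := (Finset.mem_filter.1 hI).2
    rw [polyDim, direction_affineSpan, vectorSpan_closedFace hI, hcone hI]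
end
end

section
/- Lawrence–Varchenko theorem: Let P ⊂ ℝⁿ be a full-dimensional simple polytope (every vertex lies on exactly n facets). For each vertex v of P, let w₁ᵛ, …, wₙᵛ be nonzero vectors along the n edges of P emanating from v. Let ξ ∈ ℝⁿ satisfy ⟨wᵢᵛ, ξ⟩ ≠ 0 for every vertex v and every i. Set w′ᵢᵛ = wᵢᵛ if ⟨wᵢᵛ, ξ⟩ > 0 and w′ᵢᵛ = −wᵢᵛ otherwise, let n_v = #{i : w′ᵢᵛ = −wᵢᵛ}, and define the polarized tangent cone T^ξ_{P,v} = v + {Σᵢ λᵢ w′ᵢᵛ : λᵢ ≥ 0 when w′ᵢᵛ = wᵢᵛ, and λᵢ > 0 when w′ᵢᵛ = −wᵢᵛ}. Then, as functions on ℝⁿ, 𝟙_P = Σ_v (−1)^{n_v} 𝟙_{T^ξ_{P,v}}, the sum running over all vertices v of P. -/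
open Set MeasureTheory
open scoped RealInnerProductSpace BigOperators Classical Pointwise

noncomputable section

variable {n : ℕ}
/-- The polarized tangent cone `T^ξ_{P,v}` at a vertex `v` with edge vectors `w i`:
shifted to `v`, spanned by `w' i = w i` (coefficients `≥ 0`) when `⟪w i, ξ⟫ > 0` and by
`w' i = −w i` (coefficients `> 0`) otherwise. -/
def polarCone (v : Euc n) (w : Fin n → Euc n) (ξ : Euc n) : Set (Euc n) :=
  {x | ∃ lam : Fin n → ℝ,
    (∀ i, if 0 < ⟪w i, ξ⟫ then 0 ≤ lam i else 0 < lam i) ∧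
    x = v + ∑ i, lam i • (if 0 < ⟪w i, ξ⟫ then w i else -w i)}

/-- The number `n_v` of flipped edge vectors at the vertex `v`. -/
def nflip (w : Fin n → Euc n) (ξ : Euc n) : ℕ :=
  (Finset.univ.filter fun i => ¬ 0 < ⟪w i, ξ⟫).card

/-- Points of a convex hull annihilated by a nonnegative affine form are convex combinations of
the generators annihilated by it. -/
lemma mem_convexHull_zeros {S : Set (Euc n)} (k : Euc n →ᵃ[ℝ] ℝ) (hk : ∀ s ∈ S, 0 ≤ k s)
    {y : Euc n} (hy : y ∈ convexHull ℝ S) (hky : k y = 0) :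
    y ∈ convexHull ℝ {s ∈ S | k s = 0} := by
  have h0 : ∀ z ∈ convexHull ℝ {s ∈ S | k s = 0}, k z = 0 := by
    intro z hz
    have : convexHull ℝ {s ∈ S | k s = 0} ⊆ k ⁻¹' {0} :=
      convexHull_min (fun s hs => hs.2) ((convex_singleton (0 : ℝ)).affine_preimage k)
    exact this hz
  have hconv : Convex ℝ ({z | 0 < k z} ∪ convexHull ℝ {s ∈ S | k s = 0}) := by
    rw [convex_iff_forall_pos]
    intro x hx z hz a c ha hc hac
    have hcomb : k (a • x + c • z) = a * k x + c * k z := by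
      simpa using Convex.combo_affine_apply (f := k) (x := x) (y := z) hac
    rcases hx with hx | hx <;> rcases hz with hz | hz
    · left
      simp only [mem_ofPred_eq] at hx hz ⊢
      rw [hcomb]; positivity
    · left
      simp only [mem_ofPred_eq] at hx ⊢
      rw [hcomb, h0 z hz]; simpa using mul_pos ha hx
    · left
      simp only [mem_ofPred_eq] at hz ⊢
      rw [hcomb, h0 x hx]; simpa using mul_pos hc hz
    · right
      exact convex_convexHull ℝ _ hx hz ha.le hc.le hac
  have hsub : S ⊆ {z | 0 < k z} ∪ convexHull ℝ {s ∈ S | k s = 0} := by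
    intro s hs
    rcases (hk s hs).lt_or_eq with h | h
    · exact Or.inl h
    · exact Or.inr (subset_convexHull ℝ _ ⟨hs, h.symm⟩)
  rcases convexHull_min hsub hconv hy with h | h
  · exact absurd hky (ne_of_gt h)
  · exact h

lemma exists_inner_lt_of_notMem {C : Set (Euc n)} (hC : Convex ℝ C) (hcl : IsClosed C)
    {x : Euc n} (hx : x ∉ C) : ∃ g : Euc n, ∀ y ∈ C, ⟪x, g⟫ < ⟪y, g⟫ := by
  obtain ⟨f, r, h1, h2⟩ := geometric_hahn_banach_point_closed hC hcl hx
  refine ⟨(InnerProductSpace.toDual ℝ (Euc n)).symm f, fun y hy => ?_⟩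
  rw [real_inner_comm, real_inner_comm _ y, InnerProductSpace.toDual_symm_apply,
    InnerProductSpace.toDual_symm_apply]
  exact h1.trans (h2 y hy)

/-- The convex hull of a finite set is the convex hull of those generators that are exposed
points. -/
lemma exists_exposed_generators (T : Finset (Euc n)) :
    ∃ T' ⊆ T, convexHull ℝ (T' : Set (Euc n)) = convexHull ℝ (T : Set (Euc n)) ∧
      ∀ t ∈ T', ∃ g : Euc n, ∀ y ∈ convexHull ℝ (T : Set (Euc n)), y ≠ t → ⟪y, g⟫ < ⟪t, g⟫ := by
  obtain ⟨T', hT', hmin⟩ := (T.powerset.filter fun U : Finset (Euc n) =>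
    convexHull ℝ (U : Set (Euc n)) = convexHull ℝ (T : Set (Euc n))).exists_min_image
      Finset.card ⟨T, by simp⟩
  simp only [Finset.mem_filter, Finset.mem_powerset] at hT' hmin
  refine ⟨T', hT'.1, hT'.2, fun t ht => ?_⟩
  have hnot : t ∉ convexHull ℝ ((T'.erase t : Finset (Euc n)) : Set (Euc n)) := by
    intro hmem
    have heq : convexHull ℝ ((T'.erase t : Finset (Euc n)) : Set (Euc n)) =
        convexHull ℝ (T : Set (Euc n)) := by
      rw [← hT'.2]
      refine (convexHull_mono (by simp)).antisymm (convexHull_min ?_ (convex_convexHull ℝ _))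
      intro s hs
      by_cases hst : s = t
      · rwa [hst]
      · exact subset_convexHull ℝ _ (by simpa [hst] using hs)
    have := hmin _ ⟨(Finset.erase_subset _ _).trans hT'.1, heq⟩
    exact absurd (Finset.card_erase_lt_of_mem ht) (not_lt.2 this)
  obtain ⟨g, hg⟩ := exists_inner_lt_of_notMem (convex_convexHull ℝ _)
    ((T'.erase t).finite_toSet.isClosed_convexHull (𝕜 := ℝ)) hnot
  refine ⟨-g, fun y hy hyt => ?_⟩
  rw [← hT'.2, ← Finset.insert_erase ht, Finset.coe_insert] at hy
  simp only [inner_neg_right, neg_lt_neg_iff]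
  rcases (T'.erase t).eq_empty_or_nonempty with he | hne
  · simp [he] at hy
    exact absurd hy hyt
  rw [convexHull_insert (Finset.coe_nonempty.2 hne)] at hy
  obtain ⟨_, hp, z, hz, hseg⟩ := mem_convexJoin.1 hy
  rw [mem_singleton_iff] at hp
  subst hp
  obtain ⟨a, c, ha, hc, hac, rfl⟩ := hseg
  have hc' : 0 < c := by
    refine hc.lt_of_ne ?_
    rintro rfl
    apply hyt
    simp [show a = 1 by linarith]
  have ha' : a = 1 - c := by linarith
  rw [inner_add_left, real_inner_smul_left, real_inner_smul_left, ha']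
  nlinarith [hg z hz]

lemma IsPolyFace.mem_of_singleton {P : Set (Euc n)} {v : Euc n} (hv : IsPolyFace P {v}) :
    v ∈ P := by
  rcases hv with h | ⟨u, -, r, -, h⟩
  · rw [← h]; rfl
  · have : v ∈ ({v} : Set (Euc n)) := rfl
    rw [h] at this
    exact this.1

/-- A polytope lies in the cone spanned at a vertex by the edges through it. -/
lemma exists_nonneg_combination {S : Finset (Euc n)} {P : Set (Euc n)}
    (hP : P = convexHull ℝ (S : Set (Euc n))) {v : Euc n} (hv : IsPolyFace P {v})
    {w : Fin n → Euc n}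
    (hcover : ∀ e, IsPolyFace P e → polyDim e = 1 → v ∈ e →
      ∃ i, w i ≠ 0 ∧ ∃ t : ℝ, 0 < t ∧ v + t • w i ∈ e)
    {y : Euc n} (hy : y ∈ P) :
    ∃ c : Fin n → ℝ, (∀ i, 0 ≤ c i) ∧ y - v = ∑ i, c i • w i := by
  set K : Set (Euc n) := {z | ∃ c : Fin n → ℝ, (∀ i, 0 ≤ c i) ∧ z = ∑ i, c i • w i} with hK
  have Kadd : ∀ x ∈ K, ∀ z ∈ K, x + z ∈ K := by
    rintro _ ⟨c, hc, rfl⟩ _ ⟨d, hd, rfl⟩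
    exact ⟨c + d, fun i => add_nonneg (hc i) (hd i), by
      simp [add_smul, Finset.sum_add_distrib]⟩
  have Ksmul : ∀ r : ℝ, 0 ≤ r → ∀ x ∈ K, r • x ∈ K := by
    rintro r hr _ ⟨c, hc, rfl⟩
    exact ⟨r • c, fun i => mul_nonneg hr (hc i), by simp [Finset.smul_sum, mul_smul]⟩
  have Kconv : Convex ℝ K := fun x hx z hz a c ha hc _ =>
    Kadd _ (Ksmul a ha x hx) _ (Ksmul c hc z hz)
  have hvP : v ∈ P := hv.mem_of_singleton
  obtain ⟨u, hu⟩ : ∃ u : Euc n, ∀ y ∈ P, y ≠ v → ⟪y, u⟫ < ⟪v, u⟫ := by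
    rcases hv with h | ⟨u, -, r, hr, h⟩
    · refine ⟨0, fun y hy hyv => absurd ?_ hyv⟩
      rw [← h] at hy
      exact hy
    · have hvm : v ∈ ({v} : Set (Euc n)) := rfl
      rw [h] at hvm
      refine ⟨u, fun y hy hyv => ?_⟩
      rw [hvm.2]
      refine (hr y hy).lt_of_ne fun heq => hyv ?_
      have : y ∈ ({v} : Set (Euc n)) := by rw [h]; exact ⟨hy, heq⟩
      exact this
  have hSP : ∀ s ∈ S, s ∈ P := fun s hs => by rw [hP]; exact subset_convexHull ℝ _ hs
  set φ : Euc n → Euc n := fun d => (⟪v - d, u⟫)⁻¹ • (d - v) with hφ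
  have hm : ∀ s ∈ S, s ≠ v → 0 < ⟪v - s, u⟫ := fun s hs hsv => by
    rw [inner_sub_left]; linarith [hu s (hSP s hs) hsv]
  have hφs : ∀ s ∈ S, s ≠ v → s - v = ⟪v - s, u⟫ • φ s := fun s hs hsv => by
    rw [hφ]; simp only; rw [smul_smul, mul_inv_cancel₀ (hm s hs hsv).ne', one_smul]
  have hφu : ∀ s ∈ S, s ≠ v → ⟪φ s, u⟫ = -1 := fun s hs hsv => by
    have := (hm s hs hsv).ne'
    rw [hφ]; simp only
    rw [real_inner_smul_left, ← neg_sub v s, inner_neg_left]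
    field_simp
  obtain ⟨T', hT', hconv, hexp⟩ := exists_exposed_generators ((S.erase v).image φ)
  have hT'K : ∀ t ∈ T', t ∈ K := by
    intro t ht
    obtain ⟨s, hs, hst⟩ := Finset.mem_image.1 (hT' ht)
    obtain ⟨hsv, hs⟩ := Finset.mem_erase.1 hs
    obtain ⟨g, hg⟩ := hexp t ht
    set g' : Euc n := g + ⟪t, g⟫ • u with hg'
    have hval : ∀ s ∈ S, s ≠ v → ⟪s - v, g'⟫ = ⟪v - s, u⟫ * (⟪φ s, g⟫ - ⟪t, g⟫) := by
      intro s hs hsv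
      rw [hφs s hs hsv, hg', real_inner_smul_left, inner_add_right, real_inner_smul_right,
        hφu s hs hsv]
      ring
    have hφT : ∀ s ∈ S, s ≠ v → φ s ∈ convexHull ℝ (((S.erase v).image φ : Finset (Euc n)) :
        Set (Euc n)) := fun s hs hsv =>
      subset_convexHull ℝ _ (Finset.mem_coe.2 (Finset.mem_image_of_mem _
        (Finset.mem_erase.2 ⟨hsv, hs⟩)))
    have hle : ∀ s ∈ S, ⟪s - v, g'⟫ ≤ 0 := by
      intro s hs
      by_cases hsv : s = v
      · simp [hsv]
      rw [hval s hs hsv]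
      refine mul_nonpos_of_nonneg_of_nonpos (hm s hs hsv).le ?_
      by_cases h : φ s = t
      · simp [h]
      · linarith [hg _ (hφT s hs hsv) h]
    have heq : ∀ s ∈ S, ⟪s - v, g'⟫ = 0 → ∃ r : ℝ, 0 ≤ r ∧ s - v = r • t := by
      intro s hs h0
      by_cases hsv : s = v
      · exact ⟨0, le_rfl, by simp [hsv]⟩
      refine ⟨⟪v - s, u⟫, (hm s hs hsv).le, ?_⟩
      by_cases h : φ s = t
      · rw [← h]; exact hφs s hs hsv
      · rw [hval s hs hsv] at h0
        have := hg _ (hφT s hs hsv) h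
        have := hm s hs hsv
        nlinarith
    set k : Euc n →ᵃ[ℝ] ℝ := AffineMap.const ℝ (Euc n) ⟪v, g'⟫ - (innerₗ (Euc n) g').toAffineMap
      with hk
    have hkv : ∀ y, k y = -⟪y - v, g'⟫ := by
      intro y
      simp [hk, inner_sub_left, real_inner_comm]
    have hkS : ∀ s ∈ (S : Set (Euc n)), 0 ≤ k s := fun s hs => by
      rw [hkv]; linarith [hle s hs]
    have hkP : ∀ y ∈ P, 0 ≤ k y := by
      intro y hy
      rw [hP] at hy
      exact convexHull_min (s := (S : Set (Euc n))) (t := k ⁻¹' Set.Ici 0) hkS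
        ((convex_Ici (0 : ℝ)).affine_preimage k) hy
    set e : Set (Euc n) := {y ∈ P | ⟪y, g'⟫ = ⟪v, g'⟫} with he
    have heray : ∀ y ∈ e, ∃ r : ℝ, 0 ≤ r ∧ y - v = r • t := by
      intro y hy
      have hyP := hy.1
      rw [hP] at hyP
      have hy0 := mem_convexHull_zeros k hkS hyP (by rw [hkv, inner_sub_left, hy.2]; simp)
      refine convexHull_min (t := {y | ∃ r : ℝ, 0 ≤ r ∧ y - v = r • t}) ?_ ?_ hy0
      · rintro s ⟨hs, hs0⟩
        exact heq s hs (by rw [hkv] at hs0; linarith)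
      · rintro x ⟨r, hr, hx⟩ z ⟨q, hq, hz⟩ a c ha hc hac
        refine ⟨a * r + c * q, by positivity, ?_⟩
        have : a • x + c • z - v = a • (x - v) + c • (z - v) := by
          nth_rewrite 1 [← one_smul ℝ v]
          rw [← hac]; module
        rw [this, hx, hz]; module
    have hface : IsPolyFace P e := by
      by_cases hg0 : g' = 0
      · left
        simp [he, hg0]
      · right
        refine ⟨g', hg0, ⟪v, g'⟫, fun y hy => ?_, rfl⟩
        have := hkP y hy
        rw [hkv, inner_sub_left] at this
        linarith
    have hve : v ∈ e := ⟨hvP, rfl⟩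
    have hse : s ∈ e := by
      refine ⟨hSP s hs, ?_⟩
      have := hval s hs hsv
      rw [hst, inner_sub_left] at this
      linarith
    have ht0 : t ≠ 0 := by
      rintro rfl
      have := hφu s hs hsv
      rw [hst] at this
      simp at this
    have hdim : polyDim e = 1 := by
      have : (affineSpan ℝ e).direction = ℝ ∙ t := by
        rw [direction_affineSpan]
        apply le_antisymm
        · rw [vectorSpan_eq_span_vsub_set_right ℝ hve, Submodule.span_le]
          rintro _ ⟨y, hy, rfl⟩
          obtain ⟨r, -, hr⟩ := heray y hy
          exact Submodule.mem_span_singleton.2 ⟨r, hr.symm⟩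
        · rw [Submodule.span_singleton_le_iff_mem, ← hst, hφ]
          exact Submodule.smul_mem _ _ (vsub_mem_vectorSpan ℝ hse hve)
      rw [polyDim, this, finrank_span_singleton ht0]
    obtain ⟨i, hi0, τ, hτ, hi⟩ := hcover e hface hdim hve
    obtain ⟨r, hr, hri⟩ := heray _ hi
    rw [add_sub_cancel_left] at hri
    have hr0 : r ≠ 0 := by
      rintro rfl
      rw [zero_smul, smul_eq_zero] at hri
      exact hri.elim hτ.ne' hi0
    refine ⟨Pi.single i (r⁻¹ * τ), fun j => ?_, ?_⟩
    · rcases eq_or_ne j i with rfl | h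
      · simp; positivity
      · simp [h]
    · rw [Finset.sum_eq_single i (fun j _ hj => by simp [hj]) (by simp)]
      simp [mul_smul, hri, hr0]
  have hTK : convexHull ℝ (((S.erase v).image φ : Finset (Euc n)) : Set (Euc n)) ⊆ K := by
    rw [← hconv]
    exact convexHull_min hT'K Kconv
  suffices h : P ⊆ (fun y => y + -v) ⁻¹' K by
    rw [sub_eq_add_neg]
    exact h hy
  rw [hP]
  refine convexHull_min (fun s hs => ?_) (Kconv.translate_preimage_left _)
  simp only [mem_preimage, ← sub_eq_add_neg]
  by_cases hsv : s = v
  · exact ⟨0, fun _ => le_rfl, by simp [hsv]⟩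
  · rw [hφs s hs hsv]
    exact Ksmul _ (hm s hs hsv).le _ (hTK (subset_convexHull ℝ _
      (Finset.mem_coe.2 (Finset.mem_image_of_mem _ (Finset.mem_erase.2 ⟨hsv, hs⟩)))))

/-- The edge vectors at a vertex of a full-dimensional polytope, if there are only `n` of them,
form a basis in which the polytope has nonnegative coordinates relative to the vertex. -/
lemma exists_edge_basis {S : Finset (Euc n)} {P : Set (Euc n)}
    (hP : P = convexHull ℝ (S : Set (Euc n))) (hfull : affineSpan ℝ P = ⊤)
    {v : Euc n} (hv : IsPolyFace P {v}) {w : Fin n → Euc n}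
    (hcover : ∀ e, IsPolyFace P e → polyDim e = 1 → v ∈ e →
      ∃ i, w i ≠ 0 ∧ ∃ t : ℝ, 0 < t ∧ v + t • w i ∈ e) :
    ∃ b : Module.Basis (Fin n) ℝ (Euc n), ⇑b = w ∧ ∀ y ∈ P, ∀ i, 0 ≤ b.repr (y - v) i := by
  have hmem : ∀ y ∈ P, y - v ∈ Submodule.span ℝ (range w) := by
    intro y hy
    obtain ⟨c, -, hc⟩ := exists_nonneg_combination hP hv hcover hy
    rw [hc]
    exact Submodule.sum_mem _ fun i _ => Submodule.smul_mem _ _ (Submodule.subset_span ⟨i, rfl⟩)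
  have hspan : ⊤ ≤ Submodule.span ℝ (range w) := by
    rw [← AffineSubspace.direction_top ℝ (Euc n) (Euc n), ← hfull, direction_affineSpan,
      vectorSpan_def, Submodule.span_le]
    rintro _ ⟨y, hy, z, hz, rfl⟩
    have := Submodule.sub_mem _ (hmem y hy) (hmem z hz)
    rwa [sub_sub_sub_cancel_right] at this
  refine ⟨basisOfTopLeSpanOfCardEqFinrank w hspan (by simp), by simp, fun y hy i => ?_⟩
  obtain ⟨c, hc0, hc⟩ := exists_nonneg_combination hP hv hcover hy
  have : y - v = ∑ i, c i • basisOfTopLeSpanOfCardEqFinrank w hspan (by simp) i := by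
    rw [hc]; simp
  rw [this, Module.Basis.repr_sum_self]
  exact hc0 i

/-- The affine form vanishing on the `i`-th coordinate hyperplane through `v` of the basis `b`,
normalized to take the value `1` at `p`. -/
def facetForm (b : Module.Basis (Fin n) ℝ (Euc n)) (p v : Euc n) (i : Fin n) :
    Euc n →ᵃ[ℝ] ℝ :=
  (b.repr (p - v) i)⁻¹ • ((b.coord i).toAffineMap - AffineMap.const ℝ (Euc n) (b.coord i v))

lemma facetForm_apply (b : Module.Basis (Fin n) ℝ (Euc n)) (p v : Euc n) (i : Fin n)
    (y : Euc n) : facetForm b p v i y = (b.repr (p - v) i)⁻¹ * b.repr (y - v) i := by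
  simp [facetForm]

/-- A finite set `V` of points spanning `P`, with a basis of edge vectors at each point of `V` and
a reference point `p` in the interior of all the cones spanned by these bases. -/
structure VertexFrames (P : Set (Euc n)) (p : Euc n) (V : Finset (Euc n))
    (b : Euc n → Module.Basis (Fin n) ℝ (Euc n)) : Prop where
  mem : ∀ v ∈ V, v ∈ P
  hull : P ⊆ convexHull ℝ (V : Set (Euc n))
  nonneg : ∀ v ∈ V, ∀ y ∈ P, ∀ i, 0 ≤ (b v).repr (y - v) i
  pos : ∀ v ∈ V, ∀ i, 0 < (b v).repr (p - v) i
  edge : ∀ v ∈ V, ∀ i, ∃ t : ℝ, 0 < t ∧ v + t • b v i ∈ P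

namespace VertexFrames

variable {P : Set (Euc n)} {p : Euc n} {V : Finset (Euc n)}
  {b : Euc n → Module.Basis (Fin n) ℝ (Euc n)}

lemma facetForm_nonneg (h : VertexFrames P p V b) {v : Euc n} (hv : v ∈ V) (i : Fin n)
    {y : Euc n} (hy : y ∈ P) : 0 ≤ facetForm (b v) p v i y := by
  rw [facetForm_apply]
  exact mul_nonneg (inv_nonneg.2 (h.pos v hv i).le) (h.nonneg v hv y hy i)

lemma facetForm_eq_zero_iff (h : VertexFrames P p V b) {v : Euc n} (hv : v ∈ V) (i : Fin n)
    {y : Euc n} : facetForm (b v) p v i y = 0 ↔ (b v).repr (y - v) i = 0 := by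
  rw [facetForm_apply, mul_eq_zero, or_iff_right (inv_ne_zero (h.pos v hv i).ne')]

lemma facetForm_neg_iff (h : VertexFrames P p V b) {v : Euc n} (hv : v ∈ V) (i : Fin n)
    {y : Euc n} : facetForm (b v) p v i y < 0 ↔ (b v).repr (y - v) i < 0 := by
  rw [facetForm_apply, mul_neg_iff]
  have := inv_pos.2 (h.pos v hv i)
  constructor
  · rintro (h | h)
    · exact h.2
    · linarith [h.1]
  · exact fun h => Or.inl ⟨this, h⟩

lemma facetForm_injective (h : VertexFrames P p V b) {v : Euc n} (hv : v ∈ V) :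
    Function.Injective (facetForm (b v) p v) := by
  intro i j hij
  by_contra hne
  have h0 : facetForm (b v) p v i (v + b v j) = 0 := by
    rw [h.facetForm_eq_zero_iff hv, add_sub_cancel_left]
    simp [hne]
  rw [hij, h.facetForm_eq_zero_iff hv, add_sub_cancel_left] at h0
  simp at h0

/-- A facet form vanishing at a vertex is one of the facet forms of that vertex. -/
lemma exists_facetForm_eq (h : VertexFrames P p V b) {v v' : Euc n} (hv : v ∈ V) (hv' : v' ∈ V)
    {i : Fin n} (h0 : facetForm (b v) p v i v' = 0) :
    ∃ j, facetForm (b v') p v' j = facetForm (b v) p v i := by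
  set f := facetForm (b v) p v i with hf
  set a : Fin n → ℝ := fun j => f.linear (b v' j) with ha
  have hlin : ∀ z : Euc n, f (v' + z) = f.linear z := fun z => by
    have := f.map_vadd v' z
    rw [h0, vadd_eq_add, vadd_eq_add, add_zero, add_comm] at this
    exact this
  have hexp : ∀ y, f y = ∑ j, (b v').repr (y - v') j * a j := by
    intro y
    have := hlin (y - v')
    rw [add_sub_cancel] at this
    rw [this]
    conv_lhs => rw [← (b v').sum_repr (y - v')]
    simp [ha]
  have ha0 : ∀ j, 0 ≤ a j := by
    intro j
    obtain ⟨t, ht, hmem⟩ := h.edge v' hv' j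
    have := h.facetForm_nonneg hv i hmem
    rw [← hf, hlin, map_smul, smul_eq_mul] at this
    exact nonneg_of_mul_nonneg_right this ht
  have hfp : f p = 1 := by
    rw [hf, facetForm_apply, inv_mul_cancel₀ (h.pos v hv i).ne']
  obtain ⟨j, hj⟩ : ∃ j, a j ≠ 0 := by
    by_contra! hall
    rw [hexp] at hfp
    simp [hall] at hfp
  have hcoord : ∀ k, a k ≠ 0 → ∀ z, (b v').repr z k = (b v).repr z i * (b v').repr (b v i) k := by
    intro k hk
    have hzero : ∀ y ∈ P, f y = 0 → (b v').repr (y - v') k = 0 := by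
      intro y hy hy0
      rw [hexp, Finset.sum_eq_zero_iff_of_nonneg
        (fun j _ => mul_nonneg (h.nonneg v' hv' y hy j) (ha0 j))] at hy0
      exact (mul_eq_zero.1 (hy0 k (Finset.mem_univ _))).resolve_right hk
    have hvk := hzero v (h.mem v hv) (by rw [hf, h.facetForm_eq_zero_iff hv]; simp)
    have hl : ∀ l, l ≠ i → (b v').repr (b v l) k = 0 := by
      intro l hl
      obtain ⟨t, ht, hmem⟩ := h.edge v hv l
      have := hzero _ hmem (by
        rw [hf, h.facetForm_eq_zero_iff hv, add_sub_cancel_left]; simp [hl])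
      rw [add_sub_right_comm, map_add, Finsupp.add_apply, hvk, zero_add, map_smul,
        Finsupp.smul_apply, smul_eq_mul] at this
      exact (mul_eq_zero.1 this).resolve_left ht.ne'
    intro z
    conv_lhs => rw [← (b v).sum_repr z]
    rw [map_sum, Finsupp.finsetSum_apply, Finset.sum_eq_single i]
    · simp
    · intro l _ hli
      simp [hl l hli]
    · simp
  have hother : ∀ k, k ≠ j → a k = 0 := by
    intro k hkj
    by_contra hk
    have h1 := hcoord j hj (b v' j)
    have h2 := hcoord j hj (b v' k)
    have h3 := hcoord k hk (b v' k)
    simp only [Module.Basis.repr_self, Finsupp.single_eq_same] at h1 h3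
    rw [Module.Basis.repr_self, Finsupp.single_eq_of_ne (Ne.symm hkj)] at h2
    rcases mul_eq_zero.1 h2.symm with h4 | h4
    · rw [h4] at h3; simp at h3
    · rw [h4] at h1; simp at h1
  have hval : ∀ y, f y = (b v').repr (y - v') j * a j := by
    intro y
    rw [hexp, Finset.sum_eq_single j (fun k _ hk => by simp [hother k hk]) (by simp)]
  refine ⟨j, AffineMap.ext fun y => ?_⟩
  rw [hval p] at hfp
  rw [hval, facetForm_apply, eq_inv_of_mul_eq_one_right hfp, mul_comm]

end VertexFrames

lemma sum_affineMap_apply (A : Finset (Euc n →ᵃ[ℝ] ℝ)) (z : Euc n) :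
    (∑ f ∈ A, f) z = ∑ f ∈ A, f z := by
  induction A using Finset.induction_on with
  | empty => simp
  | insert f A hf ih => rw [Finset.sum_insert hf, Finset.sum_insert hf, ← ih]; rfl

/-- Expanding products over local labels and regrouping them by globally indexed sets. -/
lemma sum_prod_ite_add {α κ ι : Type*} [Fintype ι] (V : Finset α) (H : α → ι → κ)
    (F : Finset κ) (pos : α → ι → Prop) (N : Finset κ → Prop) (a : κ → ℝ)
    (hinj : ∀ v ∈ V, Function.Injective (H v)) (hF : ∀ v ∈ V, ∀ i, H v i ∈ F)
    (hN : ∀ v ∈ V, ∀ B : Finset ι, N (B.image (H v)))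
    (hex : ∀ A ⊆ F, N A → ∃ v ∈ V, ∃ B : Finset ι, B.image (H v) = A ∧ ∀ i ∉ B, pos v i)
    (huniq : ∀ v ∈ V, ∀ v' ∈ V, ∀ B B' : Finset ι, B.image (H v) = B'.image (H v') →
      (∀ i ∉ B, pos v i) → (∀ i ∉ B', pos v' i) → v = v') :
    ∑ v ∈ V, ∏ i, (a (H v i) + if pos v i then 1 else 0) =
      ∑ A ∈ F.powerset with N A, ∏ k ∈ A, a k := by
  have hexpand : ∀ v ∈ V, ∏ i, (a (H v i) + if pos v i then 1 else 0) =
      ∑ B : Finset ι with ∀ i ∉ B, pos v i, ∏ i ∈ B, a (H v i) := by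
    intro v _
    rw [Finset.prod_add, Finset.powerset_univ, Finset.sum_filter]
    refine Finset.sum_congr rfl fun B _ => ?_
    split_ifs with hB
    · rw [Finset.prod_eq_one (s := Finset.univ \ B), mul_one]
      intro i hi
      rw [if_pos (hB i (by simpa using hi))]
    · push Not at hB
      obtain ⟨i, hi, hp⟩ := hB
      rw [Finset.prod_eq_zero (s := Finset.univ \ B) (i := i) (by simpa using hi)
        (if_neg hp), mul_zero]
  rw [Finset.sum_congr rfl hexpand, Finset.sum_sigma']
  refine Finset.sum_bij (fun x _ => x.2.image (H x.1)) ?_ ?_ ?_ ?_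
  · rintro ⟨v, B⟩ hx
    simp only [Finset.mem_sigma, Finset.mem_filter, Finset.mem_univ, true_and] at hx
    simp only [Finset.mem_filter, Finset.mem_powerset]
    exact ⟨Finset.image_subset_iff.2 fun i _ => hF v hx.1 i, hN v hx.1 B⟩
  · rintro ⟨v, B⟩ hx ⟨v', B'⟩ hx' heq
    simp only [Finset.mem_sigma, Finset.mem_filter, Finset.mem_univ, true_and] at hx hx'
    obtain rfl := huniq v hx.1 v' hx'.1 B B' heq hx.2 hx'.2
    have hBB' : B = B' := Finset.image_injective (hinj v hx.1) heq
    rw [hBB']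
  · intro A hA
    simp only [Finset.mem_filter, Finset.mem_powerset] at hA
    obtain ⟨v, hv, B, hB, hp⟩ := hex A hA.1 hA.2
    exact ⟨⟨v, B⟩, by simpa using ⟨hv, hp⟩, hB⟩
  · rintro ⟨v, B⟩ hx
    simp only [Finset.mem_sigma] at hx
    exact (Finset.prod_image fun i _ j _ hij => hinj v hx.1 hij).symm

lemma eq_zero_of_inner_nonpos (b : Module.Basis (Fin n) ℝ (Euc n)) {ξ z : Euc n}
    {B : Finset (Fin n)} (hz : ∀ i, 0 ≤ b.repr z i) (hB : ∀ i ∈ B, b.repr z i = 0)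
    (hξ : ∀ i ∉ B, 0 < ⟪b i, ξ⟫) (hle : ⟪z, ξ⟫ ≤ 0) : z = 0 := by
  have hterm : ∀ i ∈ Finset.univ, 0 ≤ b.repr z i * ⟪b i, ξ⟫ := by
    intro i _
    by_cases hi : i ∈ B
    · simp [hB i hi]
    · exact mul_nonneg (hz i) (hξ i hi).le
  have hsum : ⟪z, ξ⟫ = ∑ i, b.repr z i * ⟪b i, ξ⟫ := by
    conv_lhs => rw [← b.sum_repr z, sum_inner]
    simp only [real_inner_smul_left]
  have h0 := (Finset.sum_eq_zero_iff_of_nonneg hterm).1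
    (le_antisymm (hsum ▸ hle) (Finset.sum_nonneg hterm))
  refine b.ext_elem fun i => ?_
  rw [map_zero, Finsupp.zero_apply]
  by_cases hi : i ∈ B
  · exact hB i hi
  · exact (mul_eq_zero.1 (h0 i (Finset.mem_univ _))).resolve_right (hξ i hi).ne'

namespace VertexFrames

variable {P : Set (Euc n)} {p : Euc n} {V : Finset (Euc n)}
  {b : Euc n → Module.Basis (Fin n) ℝ (Euc n)}

/-- The polarized vertex sum, expanded over the faces of `P`; the right-hand side does not depend
on `ξ`. -/
lemma sum_prod_eq (h : VertexFrames P p V b) {ξ : Euc n}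
    (hξ : ∀ v ∈ V, ∀ i, ⟪b v i, ξ⟫ ≠ 0) (a : (Euc n →ᵃ[ℝ] ℝ) → ℝ) :
    ∑ v ∈ V, ∏ i, (a (facetForm (b v) p v i) + if 0 < ⟪b v i, ξ⟫ then 1 else 0) =
      ∑ A ∈ ((V ×ˢ Finset.univ).image fun x => facetForm (b x.1) p x.1 x.2).powerset with
        ∃ y ∈ P, ∀ f ∈ A, f y = 0, ∏ f ∈ A, a f := by
  refine sum_prod_ite_add V (fun v => facetForm (b v) p v) _ (fun v i => 0 < ⟪b v i, ξ⟫)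
    (fun A => ∃ y ∈ P, ∀ f ∈ A, f y = 0) a (fun v hv => h.facetForm_injective hv) ?_ ?_ ?_ ?_
  · exact fun v hv i => Finset.mem_image.2 ⟨(v, i), by simpa using hv, rfl⟩
  · intro v hv B
    refine ⟨v, h.mem v hv, fun f hf => ?_⟩
    obtain ⟨i, -, rfl⟩ := Finset.mem_image.1 hf
    rw [h.facetForm_eq_zero_iff hv]; simp
  · rintro A hA ⟨y, hy, hy0⟩
    have hAform : ∀ f ∈ A, ∃ v ∈ V, ∃ i, facetForm (b v) p v i = f := by
      intro f hf
      obtain ⟨⟨v, i⟩, hvi, rfl⟩ := Finset.mem_image.1 (hA hf)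
      exact ⟨v, (Finset.mem_product.1 hvi).1, i, rfl⟩
    have hAnonneg : ∀ f ∈ A, ∀ z ∈ P, 0 ≤ f z := by
      intro f hf z hz
      obtain ⟨v, hv, i, rfl⟩ := hAform f hf
      exact h.facetForm_nonneg hv i hz
    set k : Euc n →ᵃ[ℝ] ℝ := ∑ f ∈ A, f with hk
    have hkz : ∀ z, k z = ∑ f ∈ A, f z := by
      intro z
      rw [hk, sum_affineMap_apply]
    have hkV : ∀ s ∈ (V : Set (Euc n)), 0 ≤ k s := fun s hs => by
      rw [hkz]; exact Finset.sum_nonneg fun f hf => hAnonneg f hf s (h.mem s hs)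
    have hface : ∀ z ∈ P, (∀ f ∈ A, f z = 0) →
        z ∈ convexHull ℝ {s ∈ (V : Set (Euc n)) | k s = 0} := fun z hz hz0 =>
      mem_convexHull_zeros k hkV (h.hull hz) (by rw [hkz]; exact Finset.sum_eq_zero hz0)
    obtain ⟨s, hs⟩ := convexHull_nonempty_iff.1 ⟨y, hface y hy hy0⟩
    obtain ⟨v, hv, hmin⟩ := (V.filter fun s => k s = 0).exists_min_image (fun s => ⟪s, ξ⟫)
      ⟨s, by simpa using hs⟩
    simp only [Finset.mem_filter] at hv hmin
    have hminP : ∀ z ∈ P, (∀ f ∈ A, f z = 0) → ⟪v, ξ⟫ ≤ ⟪z, ξ⟫ := by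
      intro z hz hz0
      refine convexHull_min (t := {z | ⟪v, ξ⟫ ≤ ⟪z, ξ⟫}) ?_ ?_ (hface z hz hz0)
      · exact fun s hs => hmin s hs
      · rintro x hx z hz a c ha hc hac
        simp only [mem_ofPred_eq] at hx hz ⊢
        rw [inner_add_left, real_inner_smul_left, real_inner_smul_left]
        have h1 := mul_le_mul_of_nonneg_left hx ha
        have h2 := mul_le_mul_of_nonneg_left hz hc
        have h3 : a * ⟪v, ξ⟫ + c * ⟪v, ξ⟫ = ⟪v, ξ⟫ := by rw [← add_mul, hac, one_mul]
        linarith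
    have hAv : ∀ f ∈ A, ∃ j, facetForm (b v) p v j = f := by
      intro f hf
      have hfv : f v = 0 := by
        have := hv.2
        rw [hkz, Finset.sum_eq_zero_iff_of_nonneg
          (fun f hf => hAnonneg f hf v (h.mem v hv.1))] at this
        exact this f hf
      obtain ⟨v', hv', i, rfl⟩ := hAform f hf
      exact h.exists_facetForm_eq hv' hv.1 hfv
    refine ⟨v, hv.1, Finset.univ.filter fun i => facetForm (b v) p v i ∈ A, ?_, ?_⟩
    · ext f
      simp only [Finset.mem_image, Finset.mem_filter, Finset.mem_univ, true_and]
      constructor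
      · rintro ⟨i, hi, rfl⟩
        exact hi
      · intro hf
        obtain ⟨j, rfl⟩ := hAv f hf
        exact ⟨j, hf, rfl⟩
    · intro i hi
      simp only [Finset.mem_filter, Finset.mem_univ, true_and] at hi
      obtain ⟨t, ht, hmem⟩ := h.edge v hv.1 i
      have := hminP _ hmem (by
        intro f hf
        obtain ⟨j, rfl⟩ := hAv f hf
        have hij : i ≠ j := by
          rintro rfl
          exact hi hf
        rw [h.facetForm_eq_zero_iff hv.1, add_sub_cancel_left]
        simp [hij])
      rw [inner_add_left, real_inner_smul_left] at this
      exact (nonneg_of_mul_nonneg_right (by linarith : 0 ≤ t * ⟪b v i, ξ⟫) ht).lt_of_ne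
        (hξ v hv.1 i).symm
  · intro v hv v' hv' B B' heq hB hB'
    have hzero : ∀ i ∈ B, (b v).repr (v' - v) i = 0 := by
      intro i hi
      have : facetForm (b v) p v i ∈ B'.image (facetForm (b v') p v') :=
        heq ▸ Finset.mem_image_of_mem _ hi
      obtain ⟨j, -, hj⟩ := Finset.mem_image.1 this
      rw [← h.facetForm_eq_zero_iff hv, ← hj, h.facetForm_eq_zero_iff hv']
      simp
    have hzero' : ∀ i ∈ B', (b v').repr (v - v') i = 0 := by
      intro i hi
      have : facetForm (b v') p v' i ∈ B.image (facetForm (b v) p v) :=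
        heq ▸ Finset.mem_image_of_mem _ hi
      obtain ⟨j, -, hj⟩ := Finset.mem_image.1 this
      rw [← h.facetForm_eq_zero_iff hv', ← hj, h.facetForm_eq_zero_iff hv]
      simp
    rcases le_total ⟪v, ξ⟫ ⟪v', ξ⟫ with hle | hle
    · exact sub_eq_zero.1 (eq_zero_of_inner_nonpos (b v')
        (h.nonneg v' hv' v (h.mem v hv)) hzero' hB' (by rw [inner_sub_left]; linarith))
    · exact (sub_eq_zero.1 (eq_zero_of_inner_nonpos (b v)
        (h.nonneg v hv v' (h.mem v' hv')) hzero hB (by rw [inner_sub_left]; linarith))).symm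

end VertexFrames

lemma mem_polarCone_iff (b : Module.Basis (Fin n) ℝ (Euc n)) (v ξ x : Euc n) :
    x ∈ polarCone v b ξ ↔
      ∀ i, if 0 < ⟪b i, ξ⟫ then 0 ≤ b.repr (x - v) i else b.repr (x - v) i < 0 := by
  constructor
  · rintro ⟨c, hc, rfl⟩ i
    have : ∑ i, c i • (if 0 < ⟪b i, ξ⟫ then b i else -b i) =
        ∑ i, (if 0 < ⟪b i, ξ⟫ then c i else -c i) • b i :=
      Finset.sum_congr rfl fun i _ => by split_ifs <;> simp
    rw [add_sub_cancel_left, this, b.repr_sum_self]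
    have := hc i
    split_ifs at this ⊢
    · exact this
    · linarith
  · intro h
    refine ⟨fun i => if 0 < ⟪b i, ξ⟫ then b.repr (x - v) i else -b.repr (x - v) i, ?_, ?_⟩
    · intro i
      have := h i
      simp only
      split_ifs at this ⊢
      · exact this
      · linarith
    · have : ∑ i, (if 0 < ⟪b i, ξ⟫ then b.repr (x - v) i else -b.repr (x - v) i) •
          (if 0 < ⟪b i, ξ⟫ then b i else -b i) = ∑ i, b.repr (x - v) i • b i :=
        Finset.sum_congr rfl fun i _ => by split_ifs <;> simp only [smul_neg, neg_smul, neg_neg]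
      rw [this, b.sum_repr, add_sub_cancel]

lemma VertexFrames.signed_indicator_eq {P : Set (Euc n)} {p : Euc n} {V : Finset (Euc n)}
    {b : Euc n → Module.Basis (Fin n) ℝ (Euc n)} (h : VertexFrames P p V b) {v : Euc n}
    (hv : v ∈ V) (ξ x : Euc n) :
    (-1 : ℝ) ^ nflip (b v) ξ * (polarCone v (b v) ξ).indicator (fun _ => (1 : ℝ)) x =
      ∏ i, ((if facetForm (b v) p v i x < 0 then -1 else 0) +
        if 0 < ⟪b v i, ξ⟫ then 1 else 0) := by
  by_cases hx : x ∈ polarCone v (b v) ξ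
  · rw [indicator_of_mem hx, mul_one, nflip, ← Finset.prod_const, Finset.prod_filter]
    refine Finset.prod_congr rfl fun i _ => ?_
    have := (mem_polarCone_iff _ _ _ _).1 hx i
    simp only [h.facetForm_neg_iff hv]
    split_ifs at this with h1
    · rw [if_neg (not_not.2 h1), if_neg (not_lt.2 this), if_pos h1, zero_add]
    · rw [if_pos h1, if_pos this, if_neg h1, add_zero]
  · rw [indicator_of_notMem hx, mul_zero]
    rw [mem_polarCone_iff, not_forall] at hx
    obtain ⟨i, hi⟩ := hx
    refine (Finset.prod_eq_zero (Finset.mem_univ i) ?_).symm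
    simp only [h.facetForm_neg_iff hv]
    split_ifs at hi with h1
    · rw [if_pos (not_le.1 hi), if_pos h1, neg_add_cancel]
    · rw [if_neg hi, if_neg h1, add_zero]

/-- A nonempty open set contains a vector orthogonal to none of finitely many nonzero vectors. -/
lemma exists_mem_forall_inner_ne_zero (W : Finset (Euc n)) (hW : ∀ w ∈ W, w ≠ 0)
    {U : Set (Euc n)} (hU : IsOpen U) (hne : U.Nonempty) :
    ∃ ξ ∈ U, ∀ w ∈ W, ⟪w, ξ⟫ ≠ 0 := by
  induction W using Finset.induction_on generalizing U with
  | empty => exact ⟨hne.some, hne.some_mem, by simp⟩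
  | insert w W hw ih =>
    have hw0 : w ≠ 0 := hW w (Finset.mem_insert_self _ _)
    obtain ⟨ξ, ⟨hξU, hξw⟩, hξ⟩ := ih (fun w' h' => hW w' (Finset.mem_insert_of_mem h'))
      (U := U ∩ {ξ | ⟪w, ξ⟫ ≠ 0})
      (hU.inter (isOpen_ne_fun (by fun_prop) continuous_const)) (by
        obtain ⟨ξ, hξ⟩ := hne
        by_cases h0 : ⟪w, ξ⟫ = 0
        · have hcont : Filter.Tendsto (fun ε : ℝ => ξ + ε • w) (nhdsWithin 0 (Ioi 0))
              (nhds ξ) := by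
            have : Continuous fun ε : ℝ => ξ + ε • w := by fun_prop
            simpa using (this.tendsto 0).mono_left nhdsWithin_le_nhds
          obtain ⟨ε, hε, hε0⟩ := ((hcont.eventually (hU.mem_nhds hξ)).and
            self_mem_nhdsWithin).exists
          refine ⟨ξ + ε • w, hε, ?_⟩
          simp only [mem_ofPred_eq]
          rw [inner_add_right, h0, real_inner_smul_right, zero_add]
          exact mul_ne_zero (ne_of_gt hε0) (inner_self_ne_zero.2 hw0)
        · exact ⟨ξ, hξ, h0⟩)
    exact ⟨ξ, hξU, by simpa using ⟨hξw, hξ⟩⟩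

/-- A point outside `P` is missed by all polarized cones for some generic polarization. -/
lemma VertexFrames.exists_generic_notMem {P : Set (Euc n)} {p : Euc n} {V : Finset (Euc n)}
    {b : Euc n → Module.Basis (Fin n) ℝ (Euc n)} (h : VertexFrames P p V b)
    (hconv : Convex ℝ P) (hcl : IsClosed P) {x : Euc n} (hx : x ∉ P) :
    ∃ ξ : Euc n, (∀ v ∈ V, ∀ i, ⟪b v i, ξ⟫ ≠ 0) ∧ ∀ v ∈ V, x ∉ polarCone v (b v) ξ := by
  obtain ⟨g, hg⟩ := exists_inner_lt_of_notMem hconv hcl hx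
  have hopen : IsOpen (⋂ v ∈ V, {ξ : Euc n | ⟪x, ξ⟫ < ⟪v, ξ⟫}) :=
    isOpen_biInter_finset fun v _ => isOpen_lt (by fun_prop) (by fun_prop)
  obtain ⟨ξ, hξU, hξ⟩ := exists_mem_forall_inner_ne_zero
    ((V ×ˢ Finset.univ).image fun z : Euc n × Fin n => b z.1 z.2) (by
      intro w hw
      obtain ⟨⟨v, i⟩, -, rfl⟩ := Finset.mem_image.1 hw
      exact (b v).ne_zero i) hopen
    ⟨g, by simpa using fun v hv => hg v (h.mem v hv)⟩
  refine ⟨ξ, fun v hv i => hξ _ (Finset.mem_image.2 ⟨(v, i), by simpa using hv, rfl⟩), ?_⟩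
  rintro v hv ⟨c, hc, hxc⟩
  have hlt : ⟪x, ξ⟫ < ⟪v, ξ⟫ := by simpa using mem_iInter₂.1 hξU v hv
  have : 0 ≤ ⟪∑ i, c i • (if 0 < ⟪b v i, ξ⟫ then b v i else -b v i), ξ⟫ := by
    rw [sum_inner]
    refine Finset.sum_nonneg fun i _ => ?_
    have := hc i
    rw [real_inner_smul_left]
    split_ifs at this ⊢ with h1
    · exact mul_nonneg this h1.le
    · rw [inner_neg_left]
      exact mul_nonneg this.le (by linarith)
  rw [hxc, inner_add_left] at hlt
  linarith

/-- A polytope is the convex hull of its vertices. -/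
lemma subset_convexHull_vertices {S : Finset (Euc n)} {P : Set (Euc n)}
    (hP : P = convexHull ℝ (S : Set (Euc n))) :
    P ⊆ convexHull ℝ {v : Euc n | IsPolyFace P {v}} := by
  obtain ⟨T, -, hT, hexp⟩ := exists_exposed_generators S
  rw [← hP] at hT hexp
  nth_rewrite 1 [← hT]
  refine convexHull_mono fun t ht => ?_
  have htP : t ∈ P := hT ▸ subset_convexHull ℝ _ ht
  obtain ⟨g, hg⟩ := hexp t ht
  by_cases hg0 : g = 0
  · left
    refine (subset_antisymm (singleton_subset_iff.2 htP) fun y hy => ?_)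
    by_contra hyt
    simpa [hg0] using hg y hy hyt
  · right
    refine ⟨g, hg0, ⟪t, g⟫, fun y hy => ?_, ?_⟩
    · by_cases hyt : y = t
      · rw [hyt]
      · exact (hg y hy hyt).le
    · ext y
      constructor
      · rintro rfl
        exact ⟨htP, rfl⟩
      · rintro ⟨hy, hyg⟩
        by_contra hyt
        exact (hg y hy hyt).ne hyg

/-- **Lawrence–Varchenko theorem.** For a full-dimensional simple polytope `P ⊂ ℝⁿ`, with
edge vectors `w v i` along the `n` edges emanating from each vertex `v`, and `ξ` with
`⟪w v i, ξ⟫ ≠ 0` for all `v, i`: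
`𝟙_P = Σ_v (−1)^{n_v} 𝟙_{T^ξ_{P,v}}`, the sum running over the vertices of `P`. -/
theorem lawrence_varchenko {n : ℕ} (P : Set (Euc n)) (hP : IsPolytope P)
    (hfull : affineSpan ℝ P = ⊤)
    (hsimple : ∀ v : Euc n, IsPolyFace P {v} →
      {F | IsPolyFace P F ∧ polyDim F + 1 = n ∧ v ∈ F}.ncard = n)
    (w : Euc n → Fin n → Euc n)
    (hw : ∀ v : Euc n, IsPolyFace P {v} → ∀ i, w v i ≠ 0 ∧
      ∃ e, IsPolyFace P e ∧ polyDim e = 1 ∧ v ∈ e ∧ ∃ t : ℝ, 0 < t ∧ v + t • w v i ∈ e)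
    (hcover : ∀ v : Euc n, IsPolyFace P {v} → ∀ e, IsPolyFace P e → polyDim e = 1 → v ∈ e →
      ∃ i, ∃ t : ℝ, 0 < t ∧ v + t • w v i ∈ e)
    (hdistinct : ∀ v : Euc n, IsPolyFace P {v} → ∀ i j, i ≠ j → ∀ t : ℝ, w v i ≠ t • w v j)
    (ξ : Euc n) (hξ : ∀ v : Euc n, IsPolyFace P {v} → ∀ i, ⟪w v i, ξ⟫ ≠ 0)
    (hfinV : {v : Euc n | IsPolyFace P {v}}.Finite) :
    ∀ x : Euc n,
      P.indicator (fun _ => (1 : ℝ)) x =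
        ∑ v ∈ hfinV.toFinset, (-1 : ℝ) ^ nflip (w v) ξ *
          (polarCone v (w v) ξ).indicator (fun _ => (1 : ℝ)) x := by
  obtain ⟨S, hS⟩ := hP
  have hex : ∀ v, IsPolyFace P {v} → ∃ b : Module.Basis (Fin n) ℝ (Euc n), ⇑b = w v ∧
      ∀ y ∈ P, ∀ i, 0 ≤ b.repr (y - v) i := fun v hv =>
    exists_edge_basis hS hfull hv fun e he hdim hve => by
      obtain ⟨i, hi⟩ := hcover v hv e he hdim hve
      exact ⟨i, (hw v hv i).1, hi⟩
  have : Nonempty (Module.Basis (Fin n) ℝ (Euc n)) := ⟨(EuclideanSpace.basisFun (Fin n) ℝ).toBasis⟩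
  choose! b hbw hb0 using hex
  have hconv : Convex ℝ P := hS ▸ convex_convexHull ℝ _
  have hcl : IsClosed P := hS ▸ S.finite_toSet.isClosed_convexHull (𝕜 := ℝ)
  obtain ⟨p, hp⟩ := hconv.interior_nonempty_iff_affineSpan_eq_top.2 hfull
  have hmemV : ∀ v, v ∈ hfinV.toFinset ↔ IsPolyFace P {v} := by simp
  have hfr : VertexFrames P p hfinV.toFinset b := by
    refine ⟨fun v hv => ((hmemV v).1 hv).mem_of_singleton, ?_,
      fun v hv => hb0 v ((hmemV v).1 hv), fun v hv i => ?_, fun v hv i => ?_⟩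
    · rw [hfinV.coe_toFinset]
      exact subset_convexHull_vertices hS
    · have hcont : Filter.Tendsto (fun ε : ℝ => p - ε • b v i) (nhdsWithin 0 (Ioi 0))
          (nhds p) := by
        have : Continuous fun ε : ℝ => p - ε • b v i := by fun_prop
        simpa using (this.tendsto 0).mono_left nhdsWithin_le_nhds
      obtain ⟨ε, hε, hε0⟩ := ((hcont.eventually (mem_interior_iff_mem_nhds.1 hp)).and
        self_mem_nhdsWithin).exists
      have h1 := hb0 v ((hmemV v).1 hv) _ hε i
      have h2 : (0 : ℝ) < ε := hε0
      rw [sub_right_comm, map_sub, map_smul] at h1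
      simp at h1
      simp
      linarith
    · obtain ⟨-, e, he, -, -, t, ht, hte⟩ := hw v ((hmemV v).1 hv) i
      refine ⟨t, ht, ?_⟩
      rw [hbw v ((hmemV v).1 hv)]
      rcases he with rfl | ⟨u, -, r, -, rfl⟩
      · exact hte
      · exact hte.1
  intro x
  have hterm : ∀ ζ : Euc n, ∑ v ∈ hfinV.toFinset, (-1 : ℝ) ^ nflip (b v) ζ *
      (polarCone v (b v) ζ).indicator (fun _ => (1 : ℝ)) x =
      ∑ v ∈ hfinV.toFinset, ∏ i, ((if facetForm (b v) p v i x < 0 then -1 else 0) +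
        if 0 < ⟪b v i, ζ⟫ then 1 else 0) := fun ζ =>
    Finset.sum_congr rfl fun v hv => hfr.signed_indicator_eq hv ζ x
  have hsum := hfr.sum_prod_eq (ξ := ξ)
    (fun v hv i => by rw [hbw v ((hmemV v).1 hv)]; exact hξ v ((hmemV v).1 hv) i)
    (fun f => if f x < 0 then -1 else 0)
  have hrw : ∑ v ∈ hfinV.toFinset, (-1 : ℝ) ^ nflip (w v) ξ *
      (polarCone v (w v) ξ).indicator (fun _ => (1 : ℝ)) x =
      ∑ v ∈ hfinV.toFinset, (-1 : ℝ) ^ nflip (b v) ξ *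
      (polarCone v (b v) ξ).indicator (fun _ => (1 : ℝ)) x :=
    Finset.sum_congr rfl fun v hv => by rw [hbw v ((hmemV v).1 hv)]
  rw [hrw, hterm, hsum]
  by_cases hx : x ∈ P
  · rw [indicator_of_mem hx, Finset.sum_eq_single ∅]
    · simp
    · intro A hA hA0
      obtain ⟨f, hf⟩ := Finset.nonempty_iff_ne_empty.2 hA0
      obtain ⟨⟨v, i⟩, hvi, rfl⟩ :=
        Finset.mem_image.1 (Finset.mem_powerset.1 (Finset.mem_filter.1 hA).1 hf)
      exact Finset.prod_eq_zero hf
        (if_neg (not_lt.2 (hfr.facetForm_nonneg (Finset.mem_product.1 hvi).1 i hx)))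
    · intro h
      exact absurd (Finset.mem_filter.2 ⟨Finset.empty_mem_powerset _, x, hx, by simp⟩) h
  · obtain ⟨ζ, hζ, hζx⟩ := hfr.exists_generic_notMem hconv hcl hx
    rw [indicator_of_notMem hx, ← hfr.sum_prod_eq hζ, ← hterm]
    exact (Finset.sum_eq_zero fun v hv => by simp [hζx v hv]).symm
end
end
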